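/- arXiv:1409.0064 — 2 statements merged into one kernel-verified Lean document; each statement's English description precedes it below -/
import Mathlib

section
/- Let (i_t, j_t), t ∈ ℕ, be a countable family of pairs of real numbers with 0 < i_t, j_t < 1 and i_t + j_t = 1, and let θ_t ∈ ℝ² for each t. Then the Hausdorff dimension of ⋂_{t∈ℕ} Bad_{θ_t}(i_t, j_t) equals 2. -/
open Filter Set

/-- Distance from a real number to the nearest integer. -/
noncomputable def distNearestInt (t : ℝ) : ℝ := |t - round t|

/-- The inhomogeneous set `Bad_θ(i,j)` of `(i,j)`-badly approximable pairs. -/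
def badPair (i j : ℝ) (θ : ℝ × ℝ) : Set (ℝ × ℝ) :=
  {p : ℝ × ℝ | ∃ c : ℝ, 0 < c ∧ ∀ q : ℕ, 0 < q →
    c / (q : ℝ) < max (distNearestInt ((q : ℝ) * p.1 - θ.1) ^ (1 / i))
                      (distNearestInt ((q : ℝ) * p.2 - θ.2) ^ (1 / j))}

section Aux

open scoped ENNReal NNReal


/-- Half-open box of level `m` with corner `(u,v)`. -/
def gBox (b : ℕ) (m : ℕ) (u v : ℤ) : Set (ℝ × ℝ) :=
  {z | (u : ℝ) ≤ (b : ℝ) ^ m * z.1 ∧ (b : ℝ) ^ m * z.1 < u + 1 ∧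
       (v : ℝ) ≤ (b : ℝ) ^ m * z.2 ∧ (b : ℝ) ^ m * z.2 < v + 1}

lemma digit_limit (b : ℕ) (hb : 2 ≤ b) (u : ℕ → ℤ)
    (h1 : ∀ m, (b : ℤ) * u m ≤ u (m + 1)) (h2 : ∀ m, u (m + 1) ≤ b * u m + (b - 2)) :
    ∃ x : ℝ, ∀ m, (u m : ℝ) ≤ (b : ℝ) ^ m * x ∧ (b : ℝ) ^ m * x < u m + 1 := by
  have hb0 : (0 : ℝ) < b := by positivity
  have h1' : ∀ m, (b : ℝ) * u m ≤ u (m + 1) := fun m => by exact_mod_cast h1 m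
  have h2' : ∀ m, (u (m + 1) : ℝ) ≤ b * u m + (b - 2) := fun m => by exact_mod_cast h2 m
  let lo : ℕ → ℝ := fun m => u m / (b : ℝ) ^ m
  let hi : ℕ → ℝ := fun m => (u m + 1) / (b : ℝ) ^ m
  have hlo : Monotone lo := by
    apply monotone_nat_of_le_succ
    intro m
    simp only [lo]
    rw [div_le_div_iff₀ (by positivity) (by positivity), pow_succ]
    have : (0 : ℝ) < b ^ m := by positivity
    nlinarith [h1' m]
  have hhi : StrictAnti hi := by
    apply strictAnti_nat_of_succ_lt
    intro m
    simp only [hi]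
    rw [div_lt_div_iff₀ (by positivity) (by positivity), pow_succ]
    have : (0 : ℝ) < b ^ m := by positivity
    nlinarith [h2' m]
  have hle : ∀ m n, lo m ≤ hi n := by
    intro m n
    have a1 : lo m ≤ lo (max m n) := hlo (le_max_left _ _)
    have a2 : hi (max m n) ≤ hi n := hhi.antitone (le_max_right _ _)
    have a3 : lo (max m n) ≤ hi (max m n) := by
      simp only [lo, hi]
      gcongr
      linarith
    linarith
  refine ⟨⨆ m, lo m, fun m => ?_⟩
  have hbdd : BddAbove (range lo) := ⟨hi 0, by rintro _ ⟨m, rfl⟩; exact hle m 0⟩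
  have c1 : lo m ≤ ⨆ m, lo m := le_ciSup hbdd m
  have c2 : ⨆ m, lo m ≤ hi (m + 1) := ciSup_le fun n => hle n _
  have c3 : hi (m + 1) < hi m := hhi (Nat.lt_succ_self m)
  have hp : (0 : ℝ) < b ^ m := by positivity
  constructor
  · rw [mul_comm]; exact (div_le_iff₀ hp).1 c1
  · rw [mul_comm]; exact (lt_div_iff₀ hp).1 (lt_of_le_of_lt c2 c3)

lemma gBox_child (b m : ℕ) (hb : 2 ≤ b) (u v : ℤ) (d : ℕ × ℕ) (hd1 : d.1 < b - 1) (hd2 : d.2 < b - 1) :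
    gBox b (m + 1) (b * u + d.1) (b * v + d.2) ⊆ gBox b m u v := by
  have hb0 : (0 : ℝ) < b := by positivity
  have e1 : (d.1 : ℝ) + 1 ≤ b := by
    have : d.1 + 1 ≤ b := by omega
    exact_mod_cast this
  have e2 : (d.2 : ℝ) + 1 ≤ b := by
    have : d.2 + 1 ≤ b := by omega
    exact_mod_cast this
  have p1 : (0 : ℝ) ≤ d.1 := by positivity
  have p2 : (0 : ℝ) ≤ d.2 := by positivity
  rintro z ⟨h1, h2, h3, h4⟩
  push_cast at h1 h2 h3 h4
  rw [pow_succ] at h1 h2 h3 h4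
  refine ⟨?_, ?_, ?_, ?_⟩
  · by_contra h; push Not at h; nlinarith
  · by_contra h; push Not at h; nlinarith
  · by_contra h; push Not at h; nlinarith
  · by_contra h; push Not at h; nlinarith

open Classical in
lemma tree_lemma (b : ℕ) (hb : 2 ≤ b) {O : Type} (Y : O → Set (ℝ × ℝ)) (lev : O → ℕ)
    (g : O → ℕ → ℝ≥0∞) (τ : ℝ≥0∞)
    (h1 : ∀ m, ∑' o, (if lev o = m then g o m else 0) ≤ τ)
    (h2 : ∀ o m u v, lev o ≤ m → g o m ≤ 2 * τ →
      2 * ∑ d ∈ Finset.range (b - 1) ×ˢ Finset.range (b - 1),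
        (if (Y o ∩ gBox b (m + 1) (b * u + d.1) (b * v + d.2)).Nonempty then g o (m + 1) else 0)
        ≤ ((b - 1 : ℕ) : ℝ≥0∞) ^ 2 * g o m)
    (h3 : ∀ o, ∃ m, lev o < m ∧ τ < g o m) :
    ∃ z : ℝ × ℝ, ∀ o, z ∉ Y o := by
  let Φ : ℕ → ℤ → ℤ → ℝ≥0∞ := fun m u v =>
    ∑' o, (if lev o < m ∧ (Y o ∩ gBox b m u v).Nonempty then g o m else 0)
  set D := Finset.range (b - 1) ×ˢ Finset.range (b - 1) with hD
  have hDc : D.card = (b - 1) ^ 2 := by simp [hD, sq]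
  have step : ∀ m u v, Φ m u v ≤ τ → ∃ d ∈ D, Φ (m + 1) (b * u + d.1) (b * v + d.2) ≤ τ := by
    intro m u v hΦ
    by_contra hcon
    push Not at hcon
    have hDne : D.Nonempty := by
      rw [← Finset.card_pos, hDc]
      have : 0 < b - 1 := by omega
      positivity
    have hlt : ∑ d ∈ D, τ < ∑ d ∈ D, Φ (m + 1) (b * u + d.1) (b * v + d.2) :=
      ENNReal.sum_lt_sum_of_nonempty hDne hcon
    set Ψ : O → ℝ≥0∞ := fun o =>
      if lev o ≤ m ∧ (Y o ∩ gBox b m u v).Nonempty then g o m else 0 with hΨ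
    have hΨle : ∑' o, Ψ o ≤ 2 * τ := by
      calc ∑' o, Ψ o ≤ ∑' o, ((if lev o < m ∧ (Y o ∩ gBox b m u v).Nonempty then g o m else 0)
            + (if lev o = m then g o m else 0)) := by
            apply ENNReal.tsum_le_tsum
            intro o
            simp only [hΨ]
            split_ifs with a1 a2 a3 a4 <;> simp_all
            omega
        _ = Φ m u v + ∑' o, (if lev o = m then g o m else 0) := ENNReal.tsum_add
        _ ≤ τ + τ := add_le_add hΦ (h1 m)
        _ = 2 * τ := (two_mul τ).symm
    have key : 2 * ∑ d ∈ D, Φ (m + 1) (b * u + d.1) (b * v + d.2)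
        ≤ ((b - 1 : ℕ) : ℝ≥0∞) ^ 2 * (2 * τ) := by
      calc 2 * ∑ d ∈ D, Φ (m + 1) (b * u + d.1) (b * v + d.2)
          = ∑' o, 2 * ∑ d ∈ D, (if lev o < m + 1 ∧
              (Y o ∩ gBox b (m + 1) (b * u + d.1) (b * v + d.2)).Nonempty
              then g o (m + 1) else 0) := by
            rw [ENNReal.tsum_mul_left, Summable.tsum_finsetSum (fun _ _ => ENNReal.summable)]
        _ ≤ ∑' o, ((b - 1 : ℕ) : ℝ≥0∞) ^ 2 * Ψ o := by
            apply ENNReal.tsum_le_tsum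
            intro o
            by_cases ho : lev o ≤ m ∧ (Y o ∩ gBox b m u v).Nonempty
            · have e : Ψ o = g o m := by simp only [hΨ]; rw [if_pos ho]
              have hg : g o m ≤ 2 * τ := by
                rw [← e]
                exact (ENNReal.le_tsum o).trans hΨle
              rw [e]
              refine le_trans ?_ (h2 o m u v ho.1 hg)
              gcongr with d hd
              split_ifs with a1 a2 <;> simp_all
            · have : ∑ d ∈ D, (if lev o < m + 1 ∧
                (Y o ∩ gBox b (m + 1) (b * u + d.1) (b * v + d.2)).Nonempty
                then g o (m + 1) else 0) = 0 := by
                apply Finset.sum_eq_zero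
                intro d hd
                rw [if_neg]
                rintro ⟨q1, q2⟩
                apply ho
                refine ⟨by omega, q2.mono ?_⟩
                simp only [hD, Finset.mem_product, Finset.mem_range] at hd
                exact inter_subset_inter_right _ (gBox_child b m hb u v d hd.1 hd.2)
              rw [this]; simp
        _ = ((b - 1 : ℕ) : ℝ≥0∞) ^ 2 * ∑' o, Ψ o := ENNReal.tsum_mul_left
        _ ≤ _ := by gcongr
    have : ∑ d ∈ D, τ = ((b - 1 : ℕ) : ℝ≥0∞) ^ 2 * τ := by
      rw [Finset.sum_const, hDc, nsmul_eq_mul]; push_cast; rfl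
    rw [this] at hlt
    have : 2 * (((b - 1 : ℕ) : ℝ≥0∞) ^ 2 * τ) < 2 * (((b - 1 : ℕ) : ℝ≥0∞) ^ 2 * τ) := by
      calc _ < 2 * ∑ d ∈ D, Φ (m + 1) (b * u + d.1) (b * v + d.2) := by
            rw [ENNReal.mul_lt_mul_iff_right (by simp) (by simp)]; exact hlt
        _ ≤ _ := key
        _ = _ := by ring
    exact lt_irrefl _ this
  choose! d hdD hd using step
  let seq : ℕ → ℤ × ℤ := fun m => Nat.rec (0, 0)
    (fun m w => (b * w.1 + (d m w.1 w.2).1, b * w.2 + (d m w.1 w.2).2)) m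
  have hseq : ∀ m, seq (m + 1) = (b * (seq m).1 + (d m (seq m).1 (seq m).2).1,
      b * (seq m).2 + (d m (seq m).1 (seq m).2).2) := fun m => rfl
  have hΦ : ∀ m, Φ m (seq m).1 (seq m).2 ≤ τ := by
    intro m
    induction m with
    | zero => simp [Φ]
    | succ m ih => rw [hseq]; exact hd m _ _ ih
  have hdm : ∀ m, (d m (seq m).1 (seq m).2).1 < b - 1 ∧ (d m (seq m).1 (seq m).2).2 < b - 1 := by
    intro m
    have := hdD m _ _ (hΦ m)
    simpa [hD] using this
  obtain ⟨x, hx⟩ := digit_limit b hb (fun m => (seq m).1)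
    (fun m => by simp only [hseq]; omega)
    (fun m => by have := (hdm m).1; simp only [hseq]; omega)
  obtain ⟨y, hy⟩ := digit_limit b hb (fun m => (seq m).2)
    (fun m => by simp only [hseq]; omega)
    (fun m => by have := (hdm m).2; simp only [hseq]; omega)
  refine ⟨(x, y), fun o ho => ?_⟩
  obtain ⟨m, hm, hgm⟩ := h3 o
  have hmem : ((x, y) : ℝ × ℝ) ∈ gBox b m (seq m).1 (seq m).2 :=
    ⟨(hx m).1, (hx m).2, (hy m).1, (hy m).2⟩
  have h5 : g o m ≤ Φ m (seq m).1 (seq m).2 := by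
    refine le_trans ?_ (ENNReal.le_tsum o)
    rw [if_pos ⟨hm, ⟨(x, y), ho, hmem⟩⟩]
  exact absurd (h5.trans (hΦ m)) (not_le.2 hgm)

/-- `F` is covered by countably many families of tubes with total budget `τ`. -/
def Thin (β : ℕ) (τ : ℝ≥0∞) (F : Set (ℝ × ℝ)) : Prop :=
  ∃ (Y : ℕ → ℕ → Set (ℝ × ℝ)) (μ : ℕ → ℝ), (∀ k, 0 < μ k) ∧
    ∑' k, ENNReal.ofReal (μ k) ≤ τ ∧ (F ⊆ ⋃ m, ⋃ k, Y m k) ∧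
    ∀ m k, ∀ S ⊆ Y m k,
      (∀ z ∈ S, ∀ z' ∈ S, |z.1 - z'.1| ≤ (((β : ℝ) ^ 2) ^ m)⁻¹ ∧
        |z.2 - z'.2| ≤ (((β : ℝ) ^ 2) ^ m)⁻¹) →
      ∃ A B C : ℝ, 0 < max |A| |B| ∧ ∀ z ∈ S,
        |A * z.1 + B * z.2 + C| ≤ μ k ^ 2 * (((β : ℝ) ^ 2) ^ m)⁻¹ * max |A| |B|

lemma Thin.iUnion {β : ℕ} {τ : ℕ → ℝ≥0∞} {F : ℕ → Set (ℝ × ℝ)} (h : ∀ t, Thin β (τ t) (F t)) :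
    Thin β (∑' t, τ t) (⋃ t, F t) := by
  choose Y μ h1 h2 h3 h4 using h
  refine ⟨fun m k => Y (Nat.unpair k).1 m (Nat.unpair k).2,
    fun k => μ (Nat.unpair k).1 (Nat.unpair k).2, fun k => h1 _ _, ?_, ?_, fun m k => h4 _ _ _⟩
  · have : ∑' k : ℕ, ENNReal.ofReal (μ (Nat.unpair k).1 (Nat.unpair k).2)
        = ∑' p : ℕ × ℕ, ENNReal.ofReal (μ p.1 p.2) :=
      Nat.pairEquiv.symm.tsum_eq (fun p : ℕ × ℕ => ENNReal.ofReal (μ p.1 p.2))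
    rw [this, ENNReal.tsum_prod (f := fun t k => ENNReal.ofReal (μ t k))]
    exact ENNReal.tsum_le_tsum h2
  · intro z hz
    obtain ⟨t, ht⟩ := mem_iUnion.1 hz
    have := h3 t ht
    simp only [mem_iUnion] at this ⊢
    obtain ⟨m, k, hk⟩ := this
    exact ⟨m, Nat.pair t k, by simpa using hk⟩

lemma card_close (S : Finset ℕ) (L : ℕ) (h : ∀ a ∈ S, ∀ c ∈ S, a ≤ c + L) : S.card ≤ L + 1 := by
  rcases S.eq_empty_or_nonempty with rfl | hS
  · simp
  · have : S ⊆ Finset.Icc (S.min' hS) (S.min' hS + L) := by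
      intro a ha
      rw [Finset.mem_Icc]
      exact ⟨S.min'_le a ha, h a ha _ (S.min'_mem hS)⟩
    calc S.card ≤ _ := Finset.card_le_card this
      _ = L + 1 := by rw [Nat.card_Icc]; omega

lemma close_nat (a c L : ℕ) (u x y P : ℝ) (hP : 0 < P) (h1 : u + a ≤ P * x) (h2 : P * y < u + c + 1)
    (h : x - y ≤ L * P⁻¹) : a ≤ c + L := by
  have h3 : P * (x - y) ≤ L := by
    calc P * (x - y) ≤ P * (L * P⁻¹) := by gcongr
      _ = L := by field_simp
  have : (a : ℝ) < c + L + 1 := by nlinarith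
  have : a < c + L + 1 := by exact_mod_cast this
  omega

lemma slab_close (A B C w x y x' y' p : ℝ) (hA : 0 < |A|) (hBA : |B| ≤ |A|)
    (h1 : |A * x + B * y + C| ≤ w * |A|) (h2 : |A * x' + B * y' + C| ≤ w * |A|)
    (hy : |y - y'| ≤ p) (hw : w ≤ p) : x - x' ≤ 3 * p := by
  have e : A * (x - x') = (A * x + B * y + C) - (A * x' + B * y' + C) - B * (y - y') := by ring
  have h3 : |A| * |x - x'| ≤ |A| * (3 * p) := by
    calc |A| * |x - x'| = |A * (x - x')| := (abs_mul _ _).symm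
      _ ≤ |A * x + B * y + C| + |A * x' + B * y' + C| + |B * (y - y')| := by
          rw [e]
          exact (abs_sub _ _).trans (add_le_add_left (abs_sub _ _) _)
      _ ≤ p * |A| + p * |A| + |A| * p := by
          rw [abs_mul]
          have : w * |A| ≤ p * |A| := by gcongr
          have : |B| * |y - y'| ≤ |A| * p := by gcongr
          linarith
      _ = |A| * (3 * p) := by ring
  exact (le_abs_self _).trans (le_of_mul_le_mul_left h3 hA)

open Classical in
lemma tube_count (b m : ℕ) (hb : 2 ≤ b) (u v : ℤ) (Y : Set (ℝ × ℝ)) (w A B C : ℝ)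
    (hw : w ≤ ((b : ℝ) ^ (m + 1))⁻¹) (hM : 0 < max |A| |B|)
    (hY : ∀ z ∈ Y ∩ gBox b m u v, |A * z.1 + B * z.2 + C| ≤ w * max |A| |B|) :
    ((Finset.range (b - 1) ×ˢ Finset.range (b - 1)).filter
      (fun d : ℕ × ℕ => (Y ∩ gBox b (m + 1) (b * u + d.1) (b * v + d.2)).Nonempty)).card
      ≤ 4 * (b - 1) := by
  set P : ℝ := (b : ℝ) ^ (m + 1) with hP
  have hP0 : 0 < P := by positivity
  set D := Finset.range (b - 1) ×ˢ Finset.range (b - 1) with hD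
  set Dh := D.filter (fun d : ℕ × ℕ =>
    (Y ∩ gBox b (m + 1) (b * u + d.1) (b * v + d.2)).Nonempty) with hDh
  have hin : ∀ d ∈ Dh, d.1 < b - 1 ∧ d.2 < b - 1 ∧ ∃ z : ℝ × ℝ,
      |A * z.1 + B * z.2 + C| ≤ w * max |A| |B| ∧
      ((b * u : ℝ) + d.1 ≤ P * z.1 ∧ P * z.1 < b * u + d.1 + 1 ∧
        (b * v : ℝ) + d.2 ≤ P * z.2 ∧ P * z.2 < b * v + d.2 + 1) := by
    intro d hd
    simp only [hDh, hD, Finset.mem_filter, Finset.mem_product, Finset.mem_range] at hd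
    obtain ⟨⟨d1, d2⟩, z, hz1, hz2⟩ := hd
    refine ⟨d1, d2, z, hY z ⟨hz1, gBox_child b m hb u v d d1 d2 hz2⟩, ?_⟩
    simpa [gBox] using hz2
  have hclose : ∀ x x' v a : ℝ, v + a ≤ P * x → P * x < v + a + 1 → v + a ≤ P * x' →
      P * x' < v + a + 1 → |x - x'| ≤ P⁻¹ := by
    intro x x' v a h1 h2 h3 h4
    have : |P * (x - x')| ≤ 1 := by rw [abs_le]; constructor <;> nlinarith
    rw [abs_mul, abs_of_pos hP0] at this
    rw [← one_div, le_div_iff₀ hP0]; linarith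
  rcases le_total |B| |A| with hBA | hAB
  · rw [max_eq_left hBA] at hM
    calc Dh.card ≤ 4 * (Finset.range (b - 1)).card := by
          apply Finset.card_le_mul_card_image_of_maps_to (f := Prod.snd)
          · intro d hd
            exact Finset.mem_range.2 (hin d hd).2.1
          · intro e he
            have hinj : Set.InjOn Prod.fst ((Dh.filter (fun d => d.2 = e) : Finset (ℕ × ℕ)) : Set (ℕ × ℕ)) := by
              intro d hd d' hd' hdd
              simp only [Finset.coe_filter, mem_ofPred_eq] at hd hd'
              exact Prod.ext hdd (hd.2.trans hd'.2.symm)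
            rw [← Finset.card_image_of_injOn hinj]
            apply card_close _ 3
            intro a ha c hc
            simp only [Finset.mem_image, Finset.mem_filter] at ha hc
            obtain ⟨d, ⟨hd, hde⟩, rfl⟩ := ha
            obtain ⟨d', ⟨hd', hde'⟩, rfl⟩ := hc
            obtain ⟨-, -, z, s1, s2, s3, s4, s5⟩ := hin d hd
            obtain ⟨-, -, z', t1, t2, t3, t4, t5⟩ := hin d' hd'
            rw [hde] at s4 s5
            rw [hde'] at t4 t5
            refine close_nat _ _ 3 _ _ _ P hP0 s2 t3 ?_
            have hy := hclose z.2 z'.2 _ _ s4 s5 t4 t5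
            rw [max_eq_left hBA] at s1 t1
            exact slab_close A B C w _ _ _ _ _ hM hBA s1 t1 hy hw
      _ = 4 * (b - 1) := by rw [Finset.card_range]
  · rw [max_eq_right hAB] at hM
    calc Dh.card ≤ 4 * (Finset.range (b - 1)).card := by
          apply Finset.card_le_mul_card_image_of_maps_to (f := Prod.fst)
          · intro d hd
            exact Finset.mem_range.2 (hin d hd).1
          · intro e he
            have hinj : Set.InjOn Prod.snd ((Dh.filter (fun d => d.1 = e) : Finset (ℕ × ℕ)) : Set (ℕ × ℕ)) := by
              intro d hd d' hd' hdd
              simp only [Finset.coe_filter, mem_ofPred_eq] at hd hd'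
              exact Prod.ext (hd.2.trans hd'.2.symm) hdd
            rw [← Finset.card_image_of_injOn hinj]
            apply card_close _ 3
            intro a ha c hc
            simp only [Finset.mem_image, Finset.mem_filter] at ha hc
            obtain ⟨d, ⟨hd, hde⟩, rfl⟩ := ha
            obtain ⟨d', ⟨hd', hde'⟩, rfl⟩ := hc
            obtain ⟨-, -, z, s1, s2, s3, s4, s5⟩ := hin d hd
            obtain ⟨-, -, z', t1, t2, t3, t4, t5⟩ := hin d' hd'
            rw [hde] at s2 s3
            rw [hde'] at t2 t3
            refine close_nat _ _ 3 _ _ _ P hP0 s4 t5 ?_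
            have hy := hclose z.1 z'.1 _ _ s2 s3 t2 t3
            rw [max_eq_right hAB] at s1 t1
            rw [add_comm (A * z.1)] at s1
            rw [add_comm (A * z'.1)] at t1
            exact slab_close B A C w _ _ _ _ _ hM hAB s1 t1 hy hw
      _ = 4 * (b - 1) := by rw [Finset.card_range]


open Classical in
lemma small_count (b m : ℕ) (u v : ℤ) (Y : Set (ℝ × ℝ)) (hb : 2 ≤ b)
    (hY : ∀ z ∈ Y, ∀ z' ∈ Y, |z.1 - z'.1| ≤ ((b : ℝ) ^ (m + 1))⁻¹ ∧
      |z.2 - z'.2| ≤ ((b : ℝ) ^ (m + 1))⁻¹) :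
    ((Finset.range (b - 1) ×ˢ Finset.range (b - 1)).filter
      (fun d : ℕ × ℕ => (Y ∩ gBox b (m + 1) (b * u + d.1) (b * v + d.2)).Nonempty)).card
      ≤ 4 := by
  set P : ℝ := (b : ℝ) ^ (m + 1) with hP
  have hP0 : 0 < P := by positivity
  set D := Finset.range (b - 1) ×ˢ Finset.range (b - 1) with hD
  set Dh := D.filter (fun d : ℕ × ℕ =>
    (Y ∩ gBox b (m + 1) (b * u + d.1) (b * v + d.2)).Nonempty) with hDh
  have hin : ∀ d ∈ Dh, ∃ z ∈ Y,
      ((b * u : ℝ) + d.1 ≤ P * z.1 ∧ P * z.1 < b * u + d.1 + 1 ∧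
        (b * v : ℝ) + d.2 ≤ P * z.2 ∧ P * z.2 < b * v + d.2 + 1) := by
    intro d hd
    simp only [hDh, hD, Finset.mem_filter, Finset.mem_product, Finset.mem_range] at hd
    obtain ⟨-, z, hz1, hz2⟩ := hd
    refine ⟨z, hz1, ?_⟩
    simpa [gBox] using hz2
  have hsub : Dh ⊆ Dh.image Prod.fst ×ˢ Dh.image Prod.snd := by
    intro d hd
    exact Finset.mem_product.2 ⟨Finset.mem_image_of_mem _ hd, Finset.mem_image_of_mem _ hd⟩
  have c1 : (Dh.image Prod.fst).card ≤ 1 + 1 := by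
    apply card_close _ 1
    intro a ha c hc
    simp only [Finset.mem_image] at ha hc
    obtain ⟨d, hd, rfl⟩ := ha
    obtain ⟨d', hd', rfl⟩ := hc
    obtain ⟨z, hz, s2, s3, s4, s5⟩ := hin d hd
    obtain ⟨z', hz', t2, t3, t4, t5⟩ := hin d' hd'
    refine close_nat _ _ 1 _ _ _ P hP0 s2 t3 ?_
    have := (le_abs_self _).trans (hY z hz z' hz').1
    simpa using this
  have c2 : (Dh.image Prod.snd).card ≤ 1 + 1 := by
    apply card_close _ 1
    intro a ha c hc
    simp only [Finset.mem_image] at ha hc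
    obtain ⟨d, hd, rfl⟩ := ha
    obtain ⟨d', hd', rfl⟩ := hc
    obtain ⟨z, hz, s2, s3, s4, s5⟩ := hin d hd
    obtain ⟨z', hz', t2, t3, t4, t5⟩ := hin d' hd'
    refine close_nat _ _ 1 _ _ _ P hP0 s4 t5 ?_
    have := (le_abs_self _).trans (hY z hz z' hz').2
    simpa using this
  calc Dh.card ≤ _ := Finset.card_le_card hsub
    _ = _ := Finset.card_product _ _
    _ ≤ (1 + 1) * (1 + 1) := Nat.mul_le_mul c1 c2
    _ = 4 := by norm_num

lemma gBox_diam (b m : ℕ) (hb : 2 ≤ b) (u v : ℤ) (z z' : ℝ × ℝ) (hz : z ∈ gBox b m u v)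
    (hz' : z' ∈ gBox b m u v) : |z.1 - z'.1| ≤ ((b : ℝ) ^ m)⁻¹ ∧ |z.2 - z'.2| ≤ ((b : ℝ) ^ m)⁻¹ := by
  have hP0 : (0 : ℝ) < (b : ℝ) ^ m := by positivity
  have aux : ∀ x x' u : ℝ, u ≤ (b : ℝ) ^ m * x → (b : ℝ) ^ m * x < u + 1 → u ≤ (b : ℝ) ^ m * x' →
      (b : ℝ) ^ m * x' < u + 1 → |x - x'| ≤ ((b : ℝ) ^ m)⁻¹ := by
    intro x x' u h1 h2 h3 h4
    have : |(b : ℝ) ^ m * (x - x')| ≤ 1 := by rw [abs_le]; constructor <;> nlinarith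
    rw [abs_mul, abs_of_pos hP0] at this
    rw [← one_div, le_div_iff₀ hP0]; linarith
  exact ⟨aux _ _ _ hz.1 hz.2.1 hz'.1 hz'.2.1, aux _ _ _ hz.2.2.1 hz.2.2.2 hz'.2.2.1 hz'.2.2.2⟩

lemma choose_beta (s : ℝ) (hs2 : s < 2) :
    ∃ β : ℕ, 9 ≤ β ∧ 8 * (((β : ℝ) ^ 2) ^ s) ≤ ((β : ℝ) ^ 2 - 1) ^ 2 := by
  have h : Tendsto (fun β : ℕ => ((β : ℝ) ^ 2) ^ (2 - s)) atTop atTop :=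
    (tendsto_rpow_atTop (by linarith)).comp
      ((tendsto_pow_atTop (by norm_num)).comp tendsto_natCast_atTop_atTop)
  obtain ⟨β, h1, h2⟩ := ((h.eventually_ge_atTop 32).and (eventually_ge_atTop 9)).exists
  refine ⟨β, h2, ?_⟩
  have h9 : (9 : ℝ) ≤ β := by exact_mod_cast h2
  set b : ℝ := (β : ℝ) ^ 2 with hb
  have hb1 : 2 ≤ b := by nlinarith
  have hbs : 0 < b ^ s := by positivity
  have e : b ^ (2 - s) * b ^ s = b ^ 2 := by
    rw [← Real.rpow_add (by linarith)]
    simp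
  nlinarith

lemma eight_le (β : ℕ) (h : 9 ≤ β) : 8 * β ≤ β ^ 2 - 1 := by
  have : 8 * β + 1 ≤ β ^ 2 := by nlinarith
  omega

open Classical in
lemma dim_ge (s : ℝ≥0) (hs0 : 0 < s) (hs2 : s < 2) (E : Set (ℝ × ℝ))
    (H : ∀ β : ℕ, 9 ≤ β → ∀ τ : ℝ≥0∞, 0 < τ → Thin β τ Eᶜ) : (s : ℝ≥0∞) ≤ dimH E := by
  by_contra hlt
  push Not at hlt
  have h0 := hausdorffMeasure_of_dimH_lt hlt
  obtain ⟨β, hβ, hβs⟩ := choose_beta s (by exact_mod_cast hs2)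
  set b : ℕ := β ^ 2 with hb
  have hb2 : 81 ≤ b := by nlinarith
  have hbR : (81 : ℝ) ≤ b := by exact_mod_cast hb2
  have hbβ : (β : ℝ) ^ 2 = b := by simp [hb]
  rw [hbβ] at hβs
  set τr : ℝ := 1 / (2 * (b : ℝ) ^ 2) with hτr
  have hτr0 : 0 < τr := by positivity
  set τ : ℝ≥0∞ := ENNReal.ofReal τr with hτ
  have hτ0 : 0 < τ := ENNReal.ofReal_pos.2 hτr0
  have hτ4 : 0 < τ / 4 := ENNReal.div_pos hτ0.ne' (by simp)
  obtain ⟨Y, μ, hμ0, hμs, hcov, htube⟩ := H β hβ (τ / 4) hτ4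
  rw [hbβ] at htube
  -- the cover
  obtain ⟨t, hEt, ht⟩ : ∃ t : ℕ → Set (ℝ × ℝ), E ⊆ ⋃ n, t n ∧
      ∑' n, Metric.ediam (t n) ^ (s : ℝ) < τ / 4 := by
    rw [MeasureTheory.Measure.hausdorffMeasure_apply] at h0
    have h1 := (ENNReal.iSup_eq_zero.1 (ENNReal.iSup_eq_zero.1 h0 1)) (by simp)
    have h2 := h1.trans_lt hτ4
    simp only [iInf_lt_iff] at h2
    obtain ⟨t, ht1, -, ht2⟩ := h2
    refine ⟨t, ht1, lt_of_le_of_lt ?_ ht2⟩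
    apply ENNReal.tsum_le_tsum
    intro n
    rcases (t n).eq_empty_or_nonempty with he | hne
    · simp [he, hs0]
    · simp [hne]
  obtain ⟨η, hη0, hηs⟩ := ENNReal.exists_pos_sum_of_countable' hτ4.ne' ℕ
  let Z : (ℕ × ℕ) ⊕ ℕ → Set (ℝ × ℝ) := Sum.elim (fun p => Y p.1 p.2) t
  let lev : (ℕ × ℕ) ⊕ ℕ → ℕ := Sum.elim (fun p => p.1) (fun _ => 0)
  let κ : ℝ≥0∞ := (b : ℝ≥0∞) ^ (s : ℝ)
  let g : (ℕ × ℕ) ⊕ ℕ → ℕ → ℝ≥0∞ := Sum.elim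
    (fun p m => ENNReal.ofReal (μ p.2 * (β : ℝ) ^ (m - p.1)))
    (fun n m => (Metric.ediam (t n) ^ (s : ℝ) + η n) * κ ^ m)
  have hfilter : ∀ (D : Finset (ℕ × ℕ)) (p : ℕ × ℕ → Prop) (c : ℝ≥0∞),
      ∑ d ∈ D, (if p d then c else 0) = ((D.filter p).card : ℝ≥0∞) * c := by
    intro D p c
    rw [← Finset.sum_filter, Finset.sum_const, nsmul_eq_mul]
  have hκ1 : κ = ENNReal.ofReal ((b : ℝ) ^ (s : ℝ)) := by
    simp only [κ]
    rw [← ENNReal.ofReal_rpow_of_pos (by positivity), ENNReal.ofReal_natCast]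
  have h2τ : 2 * τ = ENNReal.ofReal (1 / (b : ℝ) ^ 2) := by
    have : (2 : ℝ≥0∞) = ENNReal.ofReal 2 := by simp
    rw [hτ, this, ← ENNReal.ofReal_mul (by norm_num)]
    congr 1
    rw [hτr]; field_simp
  have hsub : ((b - 1 : ℕ) : ℝ) = (b : ℝ) - 1 := by push_cast [show 1 ≤ b by omega]; rfl
  have main : ∃ z : ℝ × ℝ, ∀ o, z ∉ Z o := by
    apply tree_lemma b (by omega) Z lev g τ
    · intro m
      rw [Summable.tsum_sum ENNReal.summable ENNReal.summable]
      have p1 : ∑' p : ℕ × ℕ, (if lev (Sum.inl p) = m then g (Sum.inl p) m else 0) ≤ τ / 4 := by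
        rw [ENNReal.tsum_prod (f := fun a k =>
          (if lev (Sum.inl (a, k)) = m then g (Sum.inl (a, k)) m else 0))]
        rw [tsum_eq_single m]
        · simpa [lev, g] using hμs
        · intro a ha
          simp [lev, ha]
      have p2 : ∑' n : ℕ, (if lev (Sum.inr n) = m then g (Sum.inr n) m else 0) ≤ τ / 4 + τ / 4 := by
        calc _ ≤ ∑' n, (Metric.ediam (t n) ^ (s : ℝ) + η n) := by
              apply ENNReal.tsum_le_tsum
              intro n
              split_ifs with hm
              · have : m = 0 := hm.symm
                subst this
                simp [g]
              · simp
          _ = _ := ENNReal.tsum_add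
          _ ≤ _ := add_le_add ht.le hηs.le
      calc _ ≤ τ / 4 + (τ / 4 + τ / 4) := add_le_add p1 p2
        _ ≤ τ / 4 + τ / 4 + (τ / 4 + τ / 4) := by
            rw [add_assoc]
            gcongr
            exact le_add_self
        _ = τ := by
            have : τ / 4 + τ / 4 = τ / 2 := by
              rw [← two_mul, ← mul_div_assoc, ENNReal.div_eq_div_iff] <;> try simp
              ring
            rw [this, ENNReal.add_halves]
    · rintro (⟨a, k⟩ | n) m u v hl hg
      · rw [hfilter]
        have hl' : a ≤ m := hl
        simp only [g, Sum.elim_inl] at hg ⊢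
        rw [h2τ, ENNReal.ofReal_le_ofReal_iff (by positivity)] at hg
        obtain ⟨A, B, C, hM, hABC⟩ := htube a k (Y a k ∩ gBox b m u v) inter_subset_left
          (by
            intro z hz z' hz'
            have := gBox_diam b m (by omega) u v z z' hz.2 hz'.2
            have h3 : ((b : ℝ) ^ m)⁻¹ ≤ ((b : ℝ) ^ a)⁻¹ := by
              gcongr
              linarith
            exact ⟨this.1.trans h3, this.2.trans h3⟩)
        have hw : μ k ^ 2 * ((b : ℝ) ^ a)⁻¹ ≤ ((b : ℝ) ^ (m + 1))⁻¹ := by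
          have e1 : (μ k * (β : ℝ) ^ (m - a)) ^ 2 ≤ (1 / (b : ℝ) ^ 2) ^ 2 := by
            have := (hμ0 k).le
            gcongr
          have e2 : ((β : ℝ) ^ (m - a)) ^ 2 = (b : ℝ) ^ (m - a) := by
            rw [← hbβ]; ring
          rw [mul_pow, e2] at e1
          have e3 : (b : ℝ) ^ (m - a) = (b : ℝ) ^ m * ((b : ℝ) ^ a)⁻¹ := by
            rw [pow_sub₀ _ (by positivity) hl']
          have e4 : μ k ^ 2 * ((b : ℝ) ^ a)⁻¹ = (μ k ^ 2 * (b : ℝ) ^ (m - a)) * ((b : ℝ) ^ m)⁻¹ := by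
            rw [e3]; field_simp
          rw [e4, pow_succ (b : ℝ) m, mul_inv, mul_comm _ ((b : ℝ)⁻¹)]
          gcongr
          refine e1.trans ?_
          rw [one_div, ← inv_pow]
          have : (b : ℝ)⁻¹ ≤ 1 := inv_le_one_of_one_le₀ (by linarith)
          have : 0 ≤ (b : ℝ)⁻¹ := by positivity
          calc (((b : ℝ)⁻¹) ^ 2) ^ 2 = ((b : ℝ)⁻¹) ^ 4 := by ring
            _ ≤ ((b : ℝ)⁻¹) ^ 1 := pow_le_pow_of_le_one (by assumption) (by assumption) (by norm_num)
            _ = _ := pow_one _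
        have hc := tube_count b m (by omega) u v (Y a k) _ A B C hw hM hABC
        have e5 : ENNReal.ofReal (μ k * (β : ℝ) ^ (m + 1 - a)) =
            (β : ℝ≥0∞) * ENNReal.ofReal (μ k * (β : ℝ) ^ (m - a)) := by
          rw [← ENNReal.ofReal_natCast, ← ENNReal.ofReal_mul (by positivity)]
          congr 1
          rw [show m + 1 - a = (m - a) + 1 by omega]
          ring
        rw [e5, ← mul_assoc, ← mul_assoc]
        gcongr
        have h8 := eight_le β hβ
        rw [← hb] at h8
        simp only [Z, Sum.elim_inl]
        refine le_trans (mul_le_mul_left (mul_le_mul_right (Nat.cast_le.2 hc) 2) _) ?_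
        have : 2 * (4 * (b - 1)) * β ≤ (b - 1) ^ 2 := by nlinarith
        exact_mod_cast this
      · rw [hfilter]
        simp only [g, Sum.elim_inr] at hg ⊢
        have hd : Metric.ediam (t n) ≤ ENNReal.ofReal ((b : ℝ) ^ (m + 1))⁻¹ := by
          have e1 : (Metric.ediam (t n) * (b : ℝ≥0∞) ^ (m + 1)) ^ (s : ℝ) ≤ 1 := by
            rw [ENNReal.mul_rpow_of_nonneg _ _ (by positivity)]
            have : ((b : ℝ≥0∞) ^ (m + 1)) ^ (s : ℝ) = κ ^ m * κ := by
              rw [← pow_succ, ← ENNReal.rpow_natCast, ← ENNReal.rpow_natCast, ← ENNReal.rpow_mul,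
                ← ENNReal.rpow_mul, mul_comm]
            rw [this, ← mul_assoc]
            calc _ ≤ (2 * τ) * κ := by
                  refine mul_le_mul_left ?_ κ
                  refine le_trans ?_ hg
                  gcongr
                  exact le_self_add
              _ ≤ 1 := by
                  rw [h2τ, hκ1, ← ENNReal.ofReal_mul (by positivity)]
                  rw [← ENNReal.ofReal_one]
                  apply ENNReal.ofReal_le_ofReal
                  rw [one_div, inv_mul_le_iff₀ (by positivity), mul_one]
                  calc (b : ℝ) ^ (s : ℝ) ≤ (b : ℝ) ^ (2 : ℝ) :=
                        Real.rpow_le_rpow_of_exponent_le (by linarith) (by exact_mod_cast hs2.le)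
                    _ = _ := by norm_cast
          have e2 : Metric.ediam (t n) * (b : ℝ≥0∞) ^ (m + 1) ≤ 1 := by
            by_contra hcon
            push Not at hcon
            exact absurd e1 (not_le.2 (ENNReal.one_lt_rpow hcon (by exact_mod_cast hs0)))
          rw [ENNReal.ofReal_inv_of_pos (by positivity), ENNReal.ofReal_pow (by positivity),
            ENNReal.ofReal_natCast]
          exact ENNReal.le_inv_iff_mul_le.2 e2
        have hc := small_count b m u v (t n) (by omega) (by
          intro z hz z' hz'
          have h1 : edist z z' ≤ ENNReal.ofReal ((b : ℝ) ^ (m + 1))⁻¹ :=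
            (Metric.edist_le_ediam_of_mem hz hz').trans hd
          rw [edist_dist, ENNReal.ofReal_le_ofReal_iff (by positivity), Prod.dist_eq] at h1
          exact ⟨(le_max_left _ _).trans h1, (le_max_right _ _).trans h1⟩)
        simp only [Z, Sum.elim_inr]
        rw [pow_succ κ m]
        calc _ ≤ 2 * ((4 : ℕ) * ((Metric.ediam (t n) ^ (s : ℝ) + η n) * (κ ^ m * κ))) := by
              gcongr
              exact hc
          _ = (8 * κ) * ((Metric.ediam (t n) ^ (s : ℝ) + η n) * κ ^ m) := by push_cast; ring
          _ ≤ _ := by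
              gcongr
              rw [hκ1]
              have : (8 : ℝ≥0∞) = ENNReal.ofReal 8 := by simp
              rw [this, ← ENNReal.ofReal_mul (by norm_num), ← ENNReal.ofReal_natCast,
                ← ENNReal.ofReal_pow (by positivity)]
              apply ENNReal.ofReal_le_ofReal
              rw [hsub]
              exact hβs
    · rintro (⟨a, k⟩ | n)
      · have hT : Tendsto (fun m : ℕ => μ k * (β : ℝ) ^ m) atTop atTop :=
          (tendsto_pow_atTop_atTop_of_one_lt (by exact_mod_cast (by omega : 1 < β))).const_mul_atTop (hμ0 k)
        obtain ⟨m, h1, h2⟩ := ((hT.eventually_gt_atTop τr).and (eventually_ge_atTop 1)).exists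
        refine ⟨a + m, ?_, ?_⟩
        · simp only [lev, Sum.elim_inl]; omega
        · simp only [g, Sum.elim_inl, Nat.add_sub_cancel_left]
          exact (ENNReal.ofReal_lt_ofReal_iff (lt_trans hτr0 h1)).2 h1
      · have hκgt : 1 < κ := ENNReal.one_lt_rpow (by exact_mod_cast (by omega : 1 < b)) (by exact_mod_cast hs0)
        have hT : Tendsto (fun m : ℕ => η n * κ ^ m) atTop (nhds ∞) := by
          have := ENNReal.Tendsto.const_mul (a := η n) (ENNReal.tendsto_pow_atTop_nhds_top_iff.2 hκgt)
            (Or.inl (by simp))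
          rwa [ENNReal.mul_top (hη0 n).ne'] at this
        have hev := hT.eventually (lt_mem_nhds (show τ < ∞ by simp [hτ]))
        obtain ⟨m, h1, h2⟩ := (hev.and (eventually_ge_atTop 1)).exists
        refine ⟨m, ?_, ?_⟩
        · simp only [lev, Sum.elim_inr]; omega
        · simp only [g, Sum.elim_inr]
          refine lt_of_lt_of_le h1 ?_
          gcongr
          exact le_add_self
  obtain ⟨z, hz⟩ := main
  by_cases hzE : z ∈ E
  · obtain ⟨n, hn⟩ := mem_iUnion.1 (hEt hzE)
    exact hz (Sum.inr n) hn
  · have := hcov hzE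
    simp only [mem_iUnion] at this
    obtain ⟨m, k, hk⟩ := this
    exact hz (Sum.inl (m, k)) hk


/-- Points `z` that are `(i,j)`-badly approximable with constant `c` and shift `θ`. -/
def HB (i j c : ℝ) (θ : ℝ × ℝ) : Set (ℝ × ℝ) :=
  {z | ∀ q : ℕ, 0 < q → ∀ p r : ℤ,
    ¬ (|(q : ℝ) * z.1 - p - θ.1| * (q : ℝ) ^ i ≤ c ∧ |(q : ℝ) * z.2 - r - θ.2| * (q : ℝ) ^ j ≤ c)}

structure Dat (i j c b : ℝ) (T n k : ℕ) (z : ℝ × ℝ) (q : ℕ) (p r A B C : ℤ) : Prop where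
  hq : 0 < q
  hx : |(q : ℝ) * z.1 - p| * (q : ℝ) ^ i ≤ c
  hy : |(q : ℝ) * z.2 - r| * (q : ℝ) ^ j ≤ c
  hline : A * p + B * r + C * q = 0
  hA : |(A : ℝ)| ≤ (q : ℝ) ^ i
  hB : |(B : ℝ)| ≤ (q : ℝ) ^ j
  hAB : 1 ≤ max |(A : ℝ)| |(B : ℝ)|
  hn1 : b ^ n ≤ q * max |(A : ℝ)| |(B : ℝ)|
  hn2 : q * max |(A : ℝ)| |(B : ℝ)| < b ^ (n + 1)
  hk1 : b ^ (T * k) * max |(A : ℝ)| |(B : ℝ)| ≤ max ((q : ℝ) ^ i) ((q : ℝ) ^ j)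
  hk2 : max ((q : ℝ) ^ i) ((q : ℝ) ^ j) < b ^ (T * (k + 1)) * max |(A : ℝ)| |(B : ℝ)|
  hmin : ∀ q' : ℕ, 0 < q' → q' < q → ∀ p' r' : ℤ,
    ¬ (|(q' : ℝ) * z.1 - p'| * (q' : ℝ) ^ i ≤ c ∧ |(q' : ℝ) * z.2 - r'| * (q' : ℝ) ^ j ≤ c)

/-- A line through a rational point, evaluated near that rational point. -/
lemma line_eval (i j c K q x y p r A B C : ℝ) (hq : 0 < q) (hK : 0 ≤ K)
    (hx : |q * x - p| * q ^ i ≤ c) (hy : |q * y - r| * q ^ j ≤ c)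
    (hA : |A| ≤ K * q ^ i) (hB : |B| ≤ K * q ^ j) (hl : A * p + B * r + C * q = 0) :
    |A * x + B * y + C| * q ≤ 2 * K * c := by
  have e : (A * x + B * y + C) * q = A * (q * x - p) + B * (q * y - r) := by linear_combination hl
  have h1 : |A * (q * x - p)| ≤ K * c := by
    rw [abs_mul]
    calc |A| * |q * x - p| ≤ (K * q ^ i) * |q * x - p| := by gcongr
      _ = K * (|q * x - p| * q ^ i) := by ring
      _ ≤ _ := by gcongr
  have h2 : |B * (q * y - r)| ≤ K * c := by
    rw [abs_mul]
    calc |B| * |q * y - r| ≤ (K * q ^ j) * |q * y - r| := by gcongr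
      _ = K * (|q * y - r| * q ^ j) := by ring
      _ ≤ _ := by gcongr
  calc |A * x + B * y + C| * q = |(A * x + B * y + C) * q| := by rw [abs_mul, abs_of_pos hq]
    _ ≤ |A * (q * x - p)| + |B * (q * y - r)| := by rw [e]; exact abs_add_le _ _
    _ ≤ 2 * K * c := by linarith

lemma rpow_K (K q q' i : ℝ) (hK : 1 ≤ K) (hq : 0 ≤ q) (hq' : 0 ≤ q') (h : q' ≤ K * q)
    (hi0 : 0 ≤ i) (hi1 : i ≤ 1) : q' ^ i ≤ K * q ^ i := by
  calc q' ^ i ≤ (K * q) ^ i := Real.rpow_le_rpow hq' h hi0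
    _ = K ^ i * q ^ i := Real.mul_rpow (by linarith) hq
    _ ≤ K * q ^ i := by
        gcongr
        calc K ^ i ≤ K ^ (1 : ℝ) := Real.rpow_le_rpow_of_exponent_le hK hi1
          _ = K := Real.rpow_one K

lemma Dat.compare {i j c b : ℝ} {T n k : ℕ} {z z' : ℝ × ℝ} {q q' : ℕ} {p r A B C p' r' A' B' C' : ℤ}
    (hb : 2 ≤ b) (hi : 0 < i) (hj : 0 < j)
    (h : Dat i j c b T n k z q p r A B C) (h' : Dat i j c b T n k z' q' p' r' A' B' C') :
    (q' : ℝ) ≤ b ^ (T + 1) * q := by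
  by_contra hcon
  push Not at hcon
  have hK : 1 ≤ b ^ (T + 1) := one_le_pow₀ (by linarith)
  have hqq : (q : ℝ) ≤ q' := by nlinarith [Nat.cast_nonneg (α := ℝ) q]
  have hmax : max ((q : ℝ) ^ i) ((q : ℝ) ^ j) ≤ max ((q' : ℝ) ^ i) ((q' : ℝ) ^ j) := by gcongr
  set m := max ((q : ℝ) ^ i) ((q : ℝ) ^ j)
  set m' := max ((q' : ℝ) ^ i) ((q' : ℝ) ^ j)
  have hq0 : (0 : ℝ) < q := by exact_mod_cast h.hq
  have hm0 : 0 < m := lt_of_lt_of_le (Real.rpow_pos_of_pos hq0 i) (le_max_left _ _)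
  set M := max |(A : ℝ)| |(B : ℝ)|
  set M' := max |(A' : ℝ)| |(B' : ℝ)|
  have hM : 1 ≤ M := h.hAB
  have hM' : 1 ≤ M' := h'.hAB
  have l1 : b ^ n * (b ^ (T * k)) ≤ q * m := by
    have a1 : b ^ n * (b ^ (T * k) * M) ≤ (q * M) * m :=
      mul_le_mul h.hn1 h.hk1 (by positivity) (by positivity)
    have : (b ^ n * (b ^ (T * k))) * M ≤ (q * m) * M := by linarith
    exact le_of_mul_le_mul_right this (by linarith)
  have l2 : q' * m' < b ^ (n + 1) * (b ^ (T * (k + 1))) := by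
    have a1 : (q' * M') * m' < b ^ (n + 1) * (b ^ (T * (k + 1)) * M') := by
      apply mul_lt_mul'' h'.hn2 h'.hk2 (by positivity)
      linarith
    have : (q' * m') * M' < (b ^ (n + 1) * (b ^ (T * (k + 1)))) * M' := by linarith
    exact lt_of_mul_lt_mul_right this (by linarith)
  have l3 : b ^ (n + 1) * (b ^ (T * (k + 1))) = b ^ (T + 1) * (b ^ n * (b ^ (T * k))) := by ring
  have l4 : b ^ (T + 1) * (q * m) ≤ q' * m' := by
    calc b ^ (T + 1) * (q * m) = (b ^ (T + 1) * q) * m := by ring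
      _ ≤ q' * m' := by gcongr
  have : b ^ (T + 1) * (b ^ n * (b ^ (T * k))) ≤ b ^ (T + 1) * (q * m) := by gcongr
  linarith

lemma shift_eval (A B C x y x' y' M ρ : ℝ) (hA : |A| ≤ M) (hB : |B| ≤ M)
    (hx : |x - x'| ≤ ρ) (hy : |y - y'| ≤ ρ) :
    |A * x' + B * y' + C| ≤ |A * x + B * y + C| + 2 * M * ρ := by
  have e : A * x' + B * y' + C = (A * x + B * y + C) - A * (x - x') - B * (y - y') := by ring
  have hM : 0 ≤ M := (abs_nonneg _).trans hA
  have h1 : |A * (x - x')| ≤ M * ρ := by rw [abs_mul]; gcongr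
  have h2 : |B * (y - y')| ≤ M * ρ := by rw [abs_mul]; gcongr
  rw [e]
  calc _ ≤ |A * x + B * y + C - A * (x - x')| + |B * (y - y')| := abs_sub _ _
    _ ≤ |A * x + B * y + C| + |A * (x - x')| + |B * (y - y')| := by gcongr; exact abs_sub _ _
    _ ≤ _ := by linarith

lemma lin_comb_bound (a b' u v Y η q : ℝ) (hq : 0 < q) (hY : 0 ≤ Y)
    (ha : |a| ≤ Y) (hb : |b'| ≤ Y) (hu : |u| * q ≤ η) (hv : |v| * q ≤ η) :
    |a * u - b' * v| * q ≤ 2 * Y * η := by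
  calc |a * u - b' * v| * q ≤ (|a| * |u| + |b'| * |v|) * q := by
        gcongr
        rw [← abs_mul, ← abs_mul]
        exact abs_sub _ _
    _ = |a| * (|u| * q) + |b'| * (|v| * q) := by ring
    _ ≤ Y * η + Y * η := by gcongr
    _ = _ := by ring

lemma final_bound (E K b δ Bk i q0 q1 W : ℝ) (hE : 0 ≤ E) (hK : 1 ≤ K) (hb : 2 ≤ b) (hδ : 0 < δ)
    (hi0 : 0 < i) (hi1 : i ≤ 1) (hq0 : 0 ≤ q0) (hq1 : 0 < q1) (hBk : 1 ≤ Bk)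
    (hW0 : 0 < W) (hW : Bk ^ 3 ≤ W ^ i) (h1 : q0 * W ≤ 2 * b * K * q1)
    (h2 : E * q1 ^ i ≤ 8 * K ^ 2 * b * (δ * Bk)) (h3 : 1 ≤ 4 * K * b * (δ * Bk))
    (h4 : 256 * K ^ 5 * b ^ 4 * δ ≤ 1) : E * q0 ^ i ≤ δ ^ 2 := by
  have hX : 0 < q1 ^ i := Real.rpow_pos_of_pos hq1 i
  have hq0i : 0 ≤ q0 ^ i := Real.rpow_nonneg hq0 i
  have a1 : q0 ^ i * W ^ i ≤ (2 * b * K) * q1 ^ i := by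
    rw [← Real.mul_rpow hq0 hW0.le]
    exact rpow_K _ _ _ _ (by nlinarith) hq1.le (by positivity) h1 hi0.le hi1
  have a2 : q0 ^ i * Bk ^ 3 ≤ (2 * b * K) * q1 ^ i := le_trans (by gcongr) a1
  have a3 : E * q0 ^ i * Bk ^ 3 ≤ (2 * b * K) * (8 * K ^ 2 * b * (δ * Bk)) := by
    calc E * q0 ^ i * Bk ^ 3 = E * (q0 ^ i * Bk ^ 3) := by ring
      _ ≤ E * ((2 * b * K) * q1 ^ i) := by gcongr
      _ = (2 * b * K) * (E * q1 ^ i) := by ring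
      _ ≤ _ := by gcongr
  have a4 : E * q0 ^ i * Bk ^ 2 ≤ 16 * K ^ 3 * b ^ 2 * δ := by
    have : (E * q0 ^ i * Bk ^ 2) * Bk ≤ (16 * K ^ 3 * b ^ 2 * δ) * Bk := by
      calc _ = E * q0 ^ i * Bk ^ 3 := by ring
        _ ≤ _ := a3
        _ = _ := by ring
    exact le_of_mul_le_mul_right this (by linarith)
  have a5 : 1 ≤ (4 * K * b * (δ * Bk)) ^ 2 := one_le_pow₀ h3
  have hEq : 0 ≤ E * q0 ^ i := by positivity
  calc E * q0 ^ i ≤ E * q0 ^ i * (4 * K * b * (δ * Bk)) ^ 2 := le_mul_of_one_le_right hEq a5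
    _ = (E * q0 ^ i * Bk ^ 2) * (16 * K ^ 2 * b ^ 2 * δ ^ 2) := by ring
    _ ≤ (16 * K ^ 3 * b ^ 2 * δ) * (16 * K ^ 2 * b ^ 2 * δ ^ 2) := by gcongr
    _ = (256 * K ^ 5 * b ^ 4 * δ) * δ ^ 2 := by ring
    _ ≤ 1 * δ ^ 2 := by gcongr
    _ = _ := one_mul _

lemma det_bound (A1 B1 A2 B2 X1 Y1 X2 Y2 M1 M2 K b W q : ℝ)
    (hA1 : |A1| ≤ X1) (hB1 : |B1| ≤ Y1) (hA2 : |A2| ≤ X2) (hB2 : |B2| ≤ Y2)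
    (hA1M : |A1| ≤ M1) (hB1M : |B1| ≤ M1) (hA2M : |A2| ≤ M2) (hB2M : |B2| ≤ M2)
    (hM2 : M2 ≤ b * K * M1) (hX : X2 ≤ K * X1) (hY : Y2 ≤ K * Y1) (hq : X1 * Y1 = q)
    (hb : 1 ≤ b) (hK : 1 ≤ K) (hW0 : 0 < W) (hW : W * M1 ≤ max X1 Y1) :
    |A1 * B2 - A2 * B1| * W ≤ 2 * b * K * q := by
  have hM1 : 0 ≤ M1 := (abs_nonneg _).trans hA1M
  have hX1 : 0 ≤ X1 := (abs_nonneg _).trans hA1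
  have hY1 : 0 ≤ Y1 := (abs_nonneg _).trans hB1
  have h0 : |A1 * B2 - A2 * B1| ≤ |A1| * |B2| + |A2| * |B1| := by
    rw [← abs_mul, ← abs_mul]; exact abs_sub _ _
  rcases le_total X1 Y1 with h | h
  · rw [max_eq_right h] at hW
    have h1 : |A1| * |B2| ≤ X1 * (b * K * M1) := by
      apply mul_le_mul hA1 (hB2M.trans hM2) (abs_nonneg _) hX1
    have h2 : |A2| * |B1| ≤ (K * X1) * M1 :=
      mul_le_mul (hA2.trans hX) hB1M (abs_nonneg _) (by positivity)
    have h3 : (K * X1) * M1 ≤ b * (K * X1 * M1) := le_mul_of_one_le_left (by positivity) hb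
    calc |A1 * B2 - A2 * B1| * W ≤ (2 * b * K * X1 * M1) * W := by
          gcongr; linarith
      _ = 2 * b * K * (X1 * (W * M1)) := by ring
      _ ≤ 2 * b * K * (X1 * Y1) := by gcongr
      _ = _ := by rw [hq]
  · rw [max_eq_left h] at hW
    have h1 : |A1| * |B2| ≤ M1 * (K * Y1) :=
      mul_le_mul hA1M (hB2.trans hY) (abs_nonneg _) hM1
    have h2 : |A2| * |B1| ≤ (b * K * M1) * Y1 :=
      mul_le_mul (hA2M.trans hM2) hB1 (abs_nonneg _) (by positivity)
    have h3 : M1 * (K * Y1) ≤ b * (M1 * (K * Y1)) := le_mul_of_one_le_left (by positivity) hb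
    calc |A1 * B2 - A2 * B1| * W ≤ (2 * b * K * Y1 * M1) * W := by
          gcongr; linarith
      _ = 2 * b * K * ((W * M1) * Y1) := by ring
      _ ≤ 2 * b * K * (X1 * Y1) := by gcongr
      _ = _ := by rw [hq]

lemma int_zero_of_bound (a : ℤ) (X t Bk : ℝ) (hX : Bk ≤ X) (hBk : 1 ≤ Bk) (h : |(a : ℝ)| * X ≤ t * Bk)
    (ht : t < 1) : a = 0 := by
  by_contra ha
  have h1 : (1 : ℝ) ≤ |(a : ℝ)| := by
    rw [← Int.cast_abs]; exact_mod_cast Int.one_le_abs ha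
  nlinarith


set_option maxHeartbeats 1000000 in
lemma dot_zero {i j δ b : ℝ} {T n k : ℕ} {z z' : ℝ × ℝ} {q q' : ℕ} {p r A B C p' r' A' B' C' : ℤ}
    (hb : 2 ≤ b) (hi : 0 < i) (hj : 0 < j) (hij : i + j = 1) (hTi : 3 ≤ T * i) (hTj : 3 ≤ T * j)
    (hδ : 0 < δ) (hδK : 256 * (b ^ (T + 1)) ^ 5 * b ^ 4 * δ ≤ 1)
    (h : Dat i j (δ ^ 2) b T n k z q p r A B C) (h' : Dat i j (δ ^ 2) b T n k z' q' p' r' A' B' C')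
    (hx : |z.1 - z'.1| * b ^ n ≤ δ * b ^ k) (hy : |z.2 - z'.2| * b ^ n ≤ δ * b ^ k) :
    A * p' + B * r' + C * q' = 0 := by
  by_contra hN
  have hbp : (0 : ℝ) < b := by linarith
  have c1 : (q' : ℝ) ≤ b ^ (T + 1) * q := h.compare hb hi hj h'
  have c2 : (q : ℝ) ≤ b ^ (T + 1) * q' := h'.compare hb hi hj h
  have hK : 1 ≤ b ^ (T + 1) := one_le_pow₀ (by linarith)
  have hBk : 1 ≤ b ^ k := one_le_pow₀ (by linarith)
  have hW0 : 0 < b ^ (T * k) := by positivity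
  have hWi : ∀ e : ℝ, 3 ≤ T * e → (b ^ k) ^ 3 ≤ (b ^ (T * k)) ^ e := by
    intro e he
    rw [← Real.rpow_natCast b (T * k), ← Real.rpow_mul hbp.le, ← pow_mul, ← Real.rpow_natCast b (k * 3)]
    apply Real.rpow_le_rpow_of_exponent_le (by linarith)
    push_cast
    nlinarith [Nat.cast_nonneg (α := ℝ) k]
  have hWi1 := hWi i hTi
  have hWj1 := hWi j hTj
  have hn0 : 0 < b ^ n := by positivity
  have hn1 : b ^ (n + 1) = b * b ^ n := by ring
  have hk1 := h.hk1
  have hA := h.hA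
  have hB := h.hB
  have hAB := h.hAB
  have hA' := h'.hA
  have hB' := h'.hB
  have hAB' := h'.hAB
  have hn2 := h.hn2
  have hn2' := h'.hn2
  have hn3 := h.hn1
  rw [hn1] at hn2 hn2'
  have hl : (A : ℝ) * p + B * r + C * q = 0 := by exact_mod_cast h.hline
  have hl' : (A' : ℝ) * p' + B' * r' + C' * q' = 0 := by exact_mod_cast h'.hline
  have hq : (0 : ℝ) < q := by exact_mod_cast h.hq
  have hq1 : (1 : ℝ) ≤ q := by exact_mod_cast h.hq
  have hq' : (0 : ℝ) < q' := by exact_mod_cast h'.hq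
  have hAM := le_max_left |(A : ℝ)| |(B : ℝ)|
  have hBM := le_max_right |(A : ℝ)| |(B : ℝ)|
  have hAM' := le_max_left |(A' : ℝ)| |(B' : ℝ)|
  have hBM' := le_max_right |(A' : ℝ)| |(B' : ℝ)|
  have hXY : (q : ℝ) ^ i * (q : ℝ) ^ j = q := by rw [← Real.rpow_add hq, hij, Real.rpow_one]
  have hX' : (q' : ℝ) ^ i ≤ b ^ (T + 1) * (q : ℝ) ^ i :=
    rpow_K _ _ _ _ hK hq.le hq'.le c1 hi.le (by linarith)
  have hY' : (q' : ℝ) ^ j ≤ b ^ (T + 1) * (q : ℝ) ^ j :=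
    rpow_K _ _ _ _ hK hq.le hq'.le c1 hj.le (by linarith)
  have hX : (q : ℝ) ^ i ≤ b ^ (T + 1) * (q' : ℝ) ^ i :=
    rpow_K _ _ _ _ hK hq'.le hq.le c2 hi.le (by linarith)
  have hY : (q : ℝ) ^ j ≤ b ^ (T + 1) * (q' : ℝ) ^ j :=
    rpow_K _ _ _ _ hK hq'.le hq.le c2 hj.le (by linarith)
  have hX0 : 0 < (q : ℝ) ^ i := Real.rpow_pos_of_pos hq i
  have hY0 : 0 < (q : ℝ) ^ j := Real.rpow_pos_of_pos hq j
  have hXq : (q : ℝ) ^ i ≤ q := by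
    calc (q : ℝ) ^ i ≤ (q : ℝ) ^ (1 : ℝ) := Real.rpow_le_rpow_of_exponent_le hq1 (by linarith)
      _ = q := Real.rpow_one _
  have hYq : (q : ℝ) ^ j ≤ q := by
    calc (q : ℝ) ^ j ≤ (q : ℝ) ^ (1 : ℝ) := Real.rpow_le_rpow_of_exponent_le hq1 (by linarith)
      _ = q := Real.rpow_one _
  have hWq : b ^ (T * k) ≤ q := by
    calc b ^ (T * k) ≤ b ^ (T * k) * max |(A : ℝ)| |(B : ℝ)| := le_mul_of_one_le_right hW0.le hAB
      _ ≤ _ := hk1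
      _ ≤ q := max_le hXq hYq
  have hBX : b ^ k ≤ (q : ℝ) ^ i := by
    calc b ^ k ≤ (b ^ k) ^ 3 := le_self_pow₀ hBk (by norm_num)
      _ ≤ _ := hWi1
      _ ≤ _ := Real.rpow_le_rpow hW0.le hWq hi.le
  have hBY : b ^ k ≤ (q : ℝ) ^ j := by
    calc b ^ k ≤ (b ^ k) ^ 3 := le_self_pow₀ hBk (by norm_num)
      _ ≤ _ := hWj1
      _ ≤ _ := Real.rpow_le_rpow hW0.le hWq hj.le
  have hBW : b ^ k ≤ b ^ (T * k) := by
    apply pow_le_pow_right₀ (by linarith)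
    have : 1 ≤ T := by
      rcases Nat.eq_zero_or_pos T with h0 | h0
      · rw [h0] at hTi; norm_num at hTi
      · exact h0
    exact Nat.le_mul_of_pos_left _ this
  have hmx := h.hx
  have hmy := h.hy
  have hmx' := h'.hx
  have hmy' := h'.hy
  have hmin := h.hmin
  generalize hKdef : b ^ (T + 1) = K at *
  generalize hWdef : b ^ (T * k) = W at *
  generalize hBdef : b ^ k = Bk at *
  generalize hMdef : max |(A : ℝ)| |(B : ℝ)| = M at *
  generalize hMdef' : max |(A' : ℝ)| |(B' : ℝ)| = M' at *
  have hKb5 : 1 ≤ K ^ 5 * b ^ 4 := one_le_mul_of_one_le_of_one_le (one_le_pow₀ hK) (one_le_pow₀ (by linarith))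
  have k0 : 256 * δ ≤ 1 := by
    have : 256 * δ * 1 ≤ 256 * δ * (K ^ 5 * b ^ 4) := by gcongr
    linarith
  have k1 : K * δ ≤ 1 / 256 := by
    have e : 1 ≤ K ^ 4 * b ^ 4 := one_le_mul_of_one_le_of_one_le (one_le_pow₀ hK) (one_le_pow₀ (by linarith))
    have : K * δ * 1 ≤ K * δ * (K ^ 4 * b ^ 4) := by gcongr
    linarith
  have k2 : 8 * K ^ 2 * b ^ 2 * δ ≤ 1 / 32 := by
    have e : 1 ≤ K ^ 3 * b ^ 2 := one_le_mul_of_one_le_of_one_le (one_le_pow₀ hK) (one_le_pow₀ (by linarith))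
    have : K ^ 2 * b ^ 2 * δ * 1 ≤ K ^ 2 * b ^ 2 * δ * (K ^ 3 * b ^ 2) := by gcongr
    linarith
  have k3 : 8 * K ^ 2 * b * δ < 1 := by
    have : 8 * K ^ 2 * b * δ * 1 ≤ 8 * K ^ 2 * b * δ * b := by gcongr; linarith
    linarith
  set G := δ * Bk with hG
  have hGδ : δ ≤ G := le_mul_of_one_le_right hδ.le hBk
  have hG0 : 0 < G := by linarith
  have hδ1 : δ ≤ 1 := by linarith
  have hcδ : δ ^ 2 ≤ δ := pow_le_of_le_one hδ.le hδ1 (by norm_num)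
  have hcG : δ ^ 2 ≤ G := hcδ.trans hGδ
  have hbG : G ≤ b * G := le_mul_of_one_le_left hG0.le (by linarith)
  have hxd : |z.1 - z'.1| ≤ G / b ^ n := by rwa [le_div_iff₀ hn0]
  have hyd : |z.2 - z'.2| ≤ G / b ^ n := by rwa [le_div_iff₀ hn0]
  have hxd' : |z'.1 - z.1| ≤ G / b ^ n := by rwa [abs_sub_comm]
  have hyd' : |z'.2 - z.2| ≤ G / b ^ n := by rwa [abs_sub_comm]
  have L11 : |A * z.1 + B * z.2 + C| * q ≤ 2 * 1 * δ ^ 2 :=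
    line_eval i j _ 1 _ _ _ _ _ _ _ _ hq zero_le_one hmx hmy (by simpa using hA) (by simpa using hB) hl
  have L22 : |A' * z'.1 + B' * z'.2 + C'| * q' ≤ 2 * 1 * δ ^ 2 :=
    line_eval i j _ 1 _ _ _ _ _ _ _ _ hq' zero_le_one hmx' hmy' (by simpa using hA') (by simpa using hB') hl'
  have L12 : |A * z'.1 + B * z'.2 + C| * q ≤ 2 * δ ^ 2 + 2 * b * G := by
    have s := shift_eval A B C z.1 z.2 z'.1 z'.2 M _ hAM hBM hxd hyd
    calc |A * z'.1 + B * z'.2 + C| * q ≤ (|A * z.1 + B * z.2 + C| + 2 * M * (G / b ^ n)) * q := by gcongr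
      _ = |A * z.1 + B * z.2 + C| * q + 2 * (q * M) * (G / b ^ n) := by ring
      _ ≤ 2 * 1 * δ ^ 2 + 2 * (b * b ^ n) * (G / b ^ n) := by gcongr
      _ = _ := by field_simp
  have L21 : |A' * z.1 + B' * z.2 + C'| * q ≤ 4 * K * b * G := by
    have s := shift_eval A' B' C' z'.1 z'.2 z.1 z.2 M' _ hAM' hBM' hxd' hyd'
    calc |A' * z.1 + B' * z.2 + C'| * q ≤ |A' * z.1 + B' * z.2 + C'| * (K * q') := by gcongr
      _ ≤ (|A' * z'.1 + B' * z'.2 + C'| + 2 * M' * (G / b ^ n)) * (K * q') := by gcongr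
      _ = K * (|A' * z'.1 + B' * z'.2 + C'| * q' + 2 * (q' * M') * (G / b ^ n)) := by ring
      _ ≤ K * (2 * 1 * δ ^ 2 + 2 * (b * b ^ n) * (G / b ^ n)) := by gcongr
      _ = K * (2 * δ ^ 2 + 2 * b * G) := by field_simp
      _ ≤ K * (4 * b * G) := by gcongr; linarith
      _ = _ := by ring
  have hN1 : (1 : ℝ) ≤ |(A : ℝ) * p' + B * r' + C * q'| := by
    have : (1 : ℤ) ≤ |A * p' + B * r' + C * q'| := Int.one_le_abs hN
    exact_mod_cast this
  have hN2 : |(A : ℝ) * p' + B * r' + C * q'| ≤ K * (2 * δ ^ 2 + 2 * b * G) + 2 * K * δ ^ 2 := by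
    have e : (A : ℝ) * p' + B * r' + C * q' =
        (A * z'.1 + B * z'.2 + C) * q' - A * (q' * z'.1 - p') - B * (q' * z'.2 - r') := by ring
    have a1 : |(A : ℝ) * (q' * z'.1 - p')| ≤ K * δ ^ 2 := by
      rw [abs_mul]
      calc |(A : ℝ)| * |q' * z'.1 - p'| ≤ (K * (q' : ℝ) ^ i) * |q' * z'.1 - p'| := by
            gcongr; exact hA.trans hX
        _ = K * (|q' * z'.1 - p'| * (q' : ℝ) ^ i) := by ring
        _ ≤ _ := by gcongr
    have a2 : |(B : ℝ) * (q' * z'.2 - r')| ≤ K * δ ^ 2 := by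
      rw [abs_mul]
      calc |(B : ℝ)| * |q' * z'.2 - r'| ≤ (K * (q' : ℝ) ^ j) * |q' * z'.2 - r'| := by
            gcongr; exact hB.trans hY
        _ = K * (|q' * z'.2 - r'| * (q' : ℝ) ^ j) := by ring
        _ ≤ _ := by gcongr
    have a3 : |(A * z'.1 + B * z'.2 + C) * (q' : ℝ)| ≤ K * (2 * δ ^ 2 + 2 * b * G) := by
      rw [abs_mul, abs_of_pos hq']
      calc |A * z'.1 + B * z'.2 + C| * (q' : ℝ) ≤ |A * z'.1 + B * z'.2 + C| * (K * q) := by gcongr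
        _ = K * (|A * z'.1 + B * z'.2 + C| * q) := by ring
        _ ≤ _ := by gcongr
    rw [e]
    have t1 := abs_sub ((A * z'.1 + B * z'.2 + C) * (q' : ℝ)) (A * (q' * z'.1 - p'))
    have t2 := abs_sub ((A * z'.1 + B * z'.2 + C) * (q' : ℝ) - A * (q' * z'.1 - p')) (B * (q' * z'.2 - r'))
    linarith
  have hKc : K * δ ^ 2 ≤ 1 / 256 := by
    have : K * δ ^ 2 ≤ K * δ := by gcongr
    linarith
  have hG1 : 1 ≤ 4 * K * b * G := by linarith
  have L11' : |A * z.1 + B * z.2 + C| * q ≤ 4 * K * b * G := by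
    linarith
  have hAK : |(A : ℝ)| ≤ K * (q : ℝ) ^ i := hA.trans (le_mul_of_one_le_left hX0.le hK)
  have hBK : |(B : ℝ)| ≤ K * (q : ℝ) ^ j := hB.trans (le_mul_of_one_le_left hY0.le hK)
  have E1 : |((A * B' - A' * B : ℤ) : ℝ) * z.1 - ((B * C' - B' * C : ℤ) : ℝ)| * (q : ℝ) ^ i
      ≤ 8 * K ^ 2 * b * G := by
    have := lin_comb_bound B' B _ _ _ _ q hq (by positivity) (hB'.trans hY') hBK L11' L21
    have e : ((A * B' - A' * B : ℤ) : ℝ) * z.1 - ((B * C' - B' * C : ℤ) : ℝ) =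
      B' * (A * z.1 + B * z.2 + C) - B * (A' * z.1 + B' * z.2 + C') := by push_cast; ring
    rw [← e] at this
    have h2 : (|((A * B' - A' * B : ℤ) : ℝ) * z.1 - ((B * C' - B' * C : ℤ) : ℝ)| * (q : ℝ) ^ i) * (q : ℝ) ^ j
      ≤ (8 * K ^ 2 * b * G) * (q : ℝ) ^ j := by
      rw [mul_assoc, hXY]; linarith
    exact le_of_mul_le_mul_right h2 hY0
  have E2 : |((A * B' - A' * B : ℤ) : ℝ) * z.2 - ((C * A' - C' * A : ℤ) : ℝ)| * (q : ℝ) ^ j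
      ≤ 8 * K ^ 2 * b * G := by
    have := lin_comb_bound A A' _ _ _ _ q hq (by positivity) hAK (hA'.trans hX') L21 L11'
    have e : ((A * B' - A' * B : ℤ) : ℝ) * z.2 - ((C * A' - C' * A : ℤ) : ℝ) =
      A * (A' * z.1 + B' * z.2 + C') - A' * (A * z.1 + B * z.2 + C) := by push_cast; ring
    rw [← e] at this
    have h2 : (|((A * B' - A' * B : ℤ) : ℝ) * z.2 - ((C * A' - C' * A : ℤ) : ℝ)| * (q : ℝ) ^ j) * (q : ℝ) ^ i
      ≤ (8 * K ^ 2 * b * G) * (q : ℝ) ^ i := by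
      rw [mul_assoc, mul_comm ((q : ℝ) ^ j), hXY]; linarith
    exact le_of_mul_le_mul_right h2 hX0
  have hMM : M' ≤ b * K * M := by
    have : q' * M' ≤ q' * (b * K * M) := by
      calc q' * M' ≤ b * b ^ n := hn2'.le
        _ ≤ b * (q * M) := by gcongr
        _ ≤ b * ((K * q') * M) := by gcongr
        _ = _ := by ring
    exact le_of_mul_le_mul_left this hq'
  have D : |((A * B' - A' * B : ℤ) : ℝ)| * W ≤ 2 * b * K * q := by
    push_cast
    exact det_bound A B A' B' _ _ _ _ M M' K b W q hA hB hA' hB' hAM hBM hAM' hBM' hMM hX' hY' hXY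
      (by linarith) hK hW0 hk1
  generalize hp0 : B * C' - B' * C = p0 at *
  generalize hr0 : C * A' - C' * A = r0 at *
  generalize hq0 : A * B' - A' * B = q0 at *
  by_cases hz : q0 = 0
  · have hpz : p0 = 0 := by
      apply int_zero_of_bound p0 _ (8 * K ^ 2 * b * δ) Bk hBX hBk _ k3
      rw [hz] at E1
      simp only [Int.cast_zero, zero_mul, zero_sub, abs_neg] at E1
      rw [hG] at E1; linarith
    have hrz : r0 = 0 := by
      apply int_zero_of_bound r0 _ (8 * K ^ 2 * b * δ) Bk hBY hBk _ k3
      rw [hz] at E2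
      simp only [Int.cast_zero, zero_mul, zero_sub, abs_neg] at E2
      rw [hG] at E2; linarith
    have hlZ := h'.hline
    rw [hz] at hq0; rw [hpz] at hp0; rw [hrz] at hr0
    have n1 : A' * (A * p' + B * r' + C * q') = 0 := by
      linear_combination A * hlZ - r' * hq0 + q' * hr0
    have n2 : B' * (A * p' + B * r' + C * q') = 0 := by
      linear_combination B * hlZ + p' * hq0 - q' * hp0
    have a0 : A' = 0 := by simpa [hN] using n1
    have b0 : B' = 0 := by simpa [hN] using n2
    rw [← hMdef', a0, b0] at hAB'
    norm_num at hAB'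
  · have hnat : ((q0.natAbs : ℕ) : ℝ) = |(q0 : ℝ)| := by
      rw [Nat.cast_natAbs, Int.cast_abs]
    have hlt : q0.natAbs < q := by
      have : |(q0 : ℝ)| < q := by
        by_contra hc
        push Not at hc
        have h1 : (q : ℝ) * W ≤ 2 * b * K * q := le_trans (by gcongr) D
        have h2 : W ≤ 2 * b * K := by
          have : (q : ℝ) * W ≤ q * (2 * b * K) := by linarith
          exact le_of_mul_le_mul_left this hq
        have h3 : 4 * K * b * G ≤ 4 * K * b * (δ * (2 * b * K)) := by
          rw [hG]; gcongr; exact hBW.trans h2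
        linarith
      rw [← hnat] at this
      exact_mod_cast this
    have F1 : |(q0 : ℝ) * z.1 - p0| * |(q0 : ℝ)| ^ i ≤ δ ^ 2 :=
      final_bound _ K b δ Bk i _ q W (abs_nonneg _) hK hb hδ hi (by linarith) (abs_nonneg _) hq hBk hW0
        hWi1 D E1 hG1 hδK
    have F2 : |(q0 : ℝ) * z.2 - r0| * |(q0 : ℝ)| ^ j ≤ δ ^ 2 :=
      final_bound _ K b δ Bk j _ q W (abs_nonneg _) hK hb hδ hj (by linarith) (abs_nonneg _) hq hBk hW0
        hWj1 D E2 hG1 hδK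
    rcases le_total 0 q0 with hs | hs
    · have e : |(q0 : ℝ)| = q0 := abs_of_nonneg (by exact_mod_cast hs)
      apply hmin q0.natAbs (Int.natAbs_pos.mpr hz) hlt p0 r0
      rw [hnat]
      constructor
      · rw [e] at F1 ⊢; exact F1
      · rw [e] at F2 ⊢; exact F2
    · have e : |(q0 : ℝ)| = -q0 := abs_of_nonpos (by exact_mod_cast hs)
      apply hmin q0.natAbs (Int.natAbs_pos.mpr hz) hlt (-p0) (-r0)
      rw [hnat]
      rw [e] at F1 F2 ⊢
      push_cast
      constructor
      · rw [show -(q0 : ℝ) * z.1 - -p0 = -(q0 * z.1 - p0) by ring, abs_neg]; exact F1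
      · rw [show -(q0 : ℝ) * z.2 - -r0 = -(q0 * z.2 - r0) by ring, abs_neg]; exact F2


lemma Dat.strip {i j δ b : ℝ} {T n k : ℕ} {z z' : ℝ × ℝ} {q q' : ℕ} {p r A B C p' r' A' B' C' : ℤ}
    (hb : 2 ≤ b) (hi : 0 < i) (hj : 0 < j) (hij : i + j = 1)
    (h : Dat i j (δ ^ 2) b T n k z q p r A B C) (h' : Dat i j (δ ^ 2) b T n k z' q' p' r' A' B' C')
    (h0 : A * p' + B * r' + C * q' = 0) :
    |(A : ℝ) * z'.1 + B * z'.2 + C| * b ^ n ≤ 2 * (b ^ (T + 1)) ^ 2 * δ ^ 2 * max |(A : ℝ)| |(B : ℝ)| := by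
  have c2 : (q : ℝ) ≤ b ^ (T + 1) * q' := h'.compare hb hi hj h
  have hK : 1 ≤ b ^ (T + 1) := one_le_pow₀ (by linarith)
  have hq : (0 : ℝ) < q := by exact_mod_cast h.hq
  have hq' : (0 : ℝ) < q' := by exact_mod_cast h'.hq
  have hX : (q : ℝ) ^ i ≤ b ^ (T + 1) * (q' : ℝ) ^ i :=
    rpow_K _ _ _ _ hK hq'.le hq.le c2 hi.le (by linarith)
  have hY : (q : ℝ) ^ j ≤ b ^ (T + 1) * (q' : ℝ) ^ j :=
    rpow_K _ _ _ _ hK hq'.le hq.le c2 hj.le (by linarith)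
  have hl : (A : ℝ) * p' + B * r' + C * q' = 0 := by exact_mod_cast h0
  have L := line_eval i j (δ ^ 2) (b ^ (T + 1)) q' z'.1 z'.2 p' r' A B C hq' (by linarith) h'.hx h'.hy
    (h.hA.trans hX) (h.hB.trans hY) hl
  have hM := h.hAB
  calc |(A : ℝ) * z'.1 + B * z'.2 + C| * b ^ n
      ≤ |(A : ℝ) * z'.1 + B * z'.2 + C| * (q * max |(A : ℝ)| |(B : ℝ)|) := by gcongr; exact h.hn1
    _ ≤ |(A : ℝ) * z'.1 + B * z'.2 + C| * ((b ^ (T + 1) * q') * max |(A : ℝ)| |(B : ℝ)|) := by gcongr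
    _ = b ^ (T + 1) * (|(A : ℝ) * z'.1 + B * z'.2 + C| * q') * max |(A : ℝ)| |(B : ℝ)| := by ring
    _ ≤ b ^ (T + 1) * (2 * b ^ (T + 1) * δ ^ 2) * max |(A : ℝ)| |(B : ℝ)| := by gcongr
    _ = _ := by ring

/-- Minkowski-type pigeonhole: a short integer line through a rational point. -/
lemma pigeon (i j : ℝ) (hi : 0 < i) (hj : 0 < j) (hij : i + j = 1) (q : ℕ) (hq : 0 < q) (p r : ℤ) :
    ∃ A B C : ℤ, A * p + B * r + C * q = 0 ∧ |(A : ℝ)| ≤ (q : ℝ) ^ i ∧ |(B : ℝ)| ≤ (q : ℝ) ^ j ∧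
      1 ≤ max |(A : ℝ)| |(B : ℝ)| := by
  have hqr : (0 : ℝ) < q := by exact_mod_cast hq
  set X := (q : ℝ) ^ i with hX
  set Y := (q : ℝ) ^ j with hY
  have hX0 : 0 < X := Real.rpow_pos_of_pos hqr i
  have hY0 : 0 < Y := Real.rpow_pos_of_pos hqr j
  have hXY : X * Y = q := by rw [hX, hY, ← Real.rpow_add hqr, hij, Real.rpow_one]
  let S : Finset (ℕ × ℕ) := Finset.range (⌊X⌋₊ + 1) ×ˢ Finset.range (⌊Y⌋₊ + 1)
  let f : ℕ × ℕ → ℤ := fun a => ((a.1 : ℤ) * p + a.2 * r) % q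
  let R : Finset ℤ := Finset.Ico 0 (q : ℤ)
  have hqz : (0 : ℤ) < q := by exact_mod_cast hq
  have hcard : R.card < S.card := by
    simp only [R, S, Int.card_Ico, Finset.card_product, Finset.card_range, sub_zero, Int.toNat_natCast]
    have h1 : X < ⌊X⌋₊ + 1 := Nat.lt_floor_add_one X
    have h2 : Y < ⌊Y⌋₊ + 1 := Nat.lt_floor_add_one Y
    have h3 : (q : ℝ) < (⌊X⌋₊ + 1) * (⌊Y⌋₊ + 1) := by
      rw [← hXY]; exact mul_lt_mul'' h1 h2 hX0.le hY0.le
    exact_mod_cast h3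
  have hmaps : ∀ a ∈ S, f a ∈ R := by
    intro a _
    simp only [f, R, Finset.mem_Ico]
    exact ⟨Int.emod_nonneg _ hqz.ne', Int.emod_lt_of_pos _ hqz⟩
  obtain ⟨a, ha, a', ha', hne, heq⟩ := Finset.exists_ne_map_eq_of_card_lt_of_maps_to hcard hmaps
  have hd : (q : ℤ) ∣ ((a.1 : ℤ) * p + a.2 * r) - ((a'.1 : ℤ) * p + a'.2 * r) :=
    Int.ModEq.dvd (show _ ≡ _ [ZMOD q] from heq.symm)
  obtain ⟨C, hC⟩ := hd
  have hbd : ∀ (u v : ℕ) (Z : ℝ), 0 ≤ Z → u < ⌊Z⌋₊ + 1 → v < ⌊Z⌋₊ + 1 → |(((u : ℤ) - v : ℤ) : ℝ)| ≤ Z := by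
    intro u v Z hZ hu hv
    have e1 : (u : ℝ) ≤ Z := (Nat.le_floor_iff hZ).1 (Nat.lt_succ_iff.1 hu)
    have e2 : (v : ℝ) ≤ Z := (Nat.le_floor_iff hZ).1 (Nat.lt_succ_iff.1 hv)
    push_cast
    rw [abs_le]
    constructor <;> linarith [Nat.cast_nonneg (α := ℝ) u, Nat.cast_nonneg (α := ℝ) v]
  simp only [S, Finset.mem_product, Finset.mem_range] at ha ha'
  refine ⟨(a.1 : ℤ) - a'.1, (a.2 : ℤ) - a'.2, -C, by linear_combination hC,
    hbd _ _ _ hX0.le ha.1 ha'.1, hbd _ _ _ hY0.le ha.2 ha'.2, ?_⟩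
  have key : (a.1 : ℤ) - a'.1 ≠ 0 ∨ (a.2 : ℤ) - a'.2 ≠ 0 := by
    by_contra hcon
    push Not at hcon
    apply hne
    ext <;> omega
  have one : ∀ u : ℤ, u ≠ 0 → (1 : ℝ) ≤ |(u : ℝ)| := by
    intro u hu
    rw [← Int.cast_abs]; exact_mod_cast Int.one_le_abs hu
  rcases key with h | h
  · exact le_max_of_le_left (one _ h)
  · exact le_max_of_le_right (one _ h)

lemma geom_tsum_le (β D : ℝ) (hβ : 2 ≤ β) (hD : 0 ≤ D) :
    ∑' k : ℕ, ENNReal.ofReal (D * (β ^ k)⁻¹) ≤ ENNReal.ofReal (2 * D) := by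
  have h2 : (2 : ℝ)⁻¹ < 1 := by norm_num
  have h3 : Summable (fun k : ℕ => D * (2⁻¹ : ℝ) ^ k) :=
    (summable_geometric_of_lt_one (by norm_num) h2).mul_left D
  calc ∑' k : ℕ, ENNReal.ofReal (D * (β ^ k)⁻¹)
      ≤ ∑' k : ℕ, ENNReal.ofReal (D * (2⁻¹ : ℝ) ^ k) := by
        apply ENNReal.tsum_le_tsum
        intro k
        apply ENNReal.ofReal_le_ofReal
        rw [inv_pow]
        gcongr
    _ = ENNReal.ofReal (∑' k : ℕ, D * (2⁻¹ : ℝ) ^ k) :=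
        (ENNReal.ofReal_tsum_of_nonneg (fun k => by positivity) h3).symm
    _ = ENNReal.ofReal (2 * D) := by
        congr 1
        rw [tsum_mul_left, tsum_geometric_of_lt_one (by norm_num) h2]
        ring

lemma exists_real_le (τ : ℝ≥0∞) (hτ : 0 < τ) : ∃ ε : ℝ, 0 < ε ∧ ENNReal.ofReal ε ≤ τ := by
  obtain ⟨r, h1, h2⟩ := ENNReal.lt_iff_exists_nnreal_btwn.1 hτ
  refine ⟨r, by exact_mod_cast h1, ?_⟩
  rw [ENNReal.ofReal_coe_nnreal]; exact h2.le

lemma exists_dat (i j δ b : ℝ) (T : ℕ) (hb : 2 ≤ b) (hT : 1 ≤ T) (hi : 0 < i) (hj : 0 < j) (hij : i + j = 1)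
    (z : ℝ × ℝ) (hz : z ∉ HB i j (δ ^ 2) 0) :
    ∃ n k q p r A B C, k ≤ n ∧ Dat i j (δ ^ 2) b T n k z q p r A B C := by
  classical
  have hex : ∃ q : ℕ, 0 < q ∧ ∃ p r : ℤ,
    (|(q : ℝ) * z.1 - p| * (q : ℝ) ^ i ≤ δ ^ 2 ∧ |(q : ℝ) * z.2 - r| * (q : ℝ) ^ j ≤ δ ^ 2) := by
    by_contra hcon
    push Not at hcon
    apply hz
    intro q hq p r
    simp only [Prod.fst_zero, Prod.snd_zero, sub_zero, not_and]
    intro h1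
    exact not_le.2 (hcon q hq p r h1)
  obtain ⟨hq, p, r, hx, hy⟩ := Nat.find_spec hex
  have hmin : ∀ q' < Nat.find hex, _ := fun q' hq' => Nat.find_min hex hq'
  set q := Nat.find hex with hqdef
  obtain ⟨A, B, C, hl, hA, hB, hAB⟩ := pigeon i j hi hj hij q hq p r
  have hqr : (0 : ℝ) < q := by exact_mod_cast hq
  have hq1 : (1 : ℝ) ≤ q := by exact_mod_cast hq
  have hXq : (q : ℝ) ^ i ≤ q := by
    calc (q : ℝ) ^ i ≤ (q : ℝ) ^ (1 : ℝ) := Real.rpow_le_rpow_of_exponent_le hq1 (by linarith)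
      _ = q := Real.rpow_one _
  have hYq : (q : ℝ) ^ j ≤ q := by
    calc (q : ℝ) ^ j ≤ (q : ℝ) ^ (1 : ℝ) := Real.rpow_le_rpow_of_exponent_le hq1 (by linarith)
      _ = q := Real.rpow_one _
  have hMX : max |(A : ℝ)| |(B : ℝ)| ≤ max ((q : ℝ) ^ i) ((q : ℝ) ^ j) := max_le_max hA hB
  have hM0 : 0 < max |(A : ℝ)| |(B : ℝ)| := by linarith
  obtain ⟨n, hn1, hn2⟩ := exists_nat_pow_near (x := q * max |(A : ℝ)| |(B : ℝ)|) (y := b)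
    (one_le_mul_of_one_le_of_one_le hq1 hAB) (by linarith)
  obtain ⟨k, hk1, hk2⟩ := exists_nat_pow_near
    (x := max ((q : ℝ) ^ i) ((q : ℝ) ^ j) / max |(A : ℝ)| |(B : ℝ)|) (y := b ^ T)
    ((one_le_div hM0).2 hMX) (one_lt_pow₀ (by linarith) (by omega))
  rw [le_div_iff₀ hM0, ← pow_mul] at hk1
  rw [div_lt_iff₀ hM0, ← pow_mul] at hk2
  refine ⟨n, k, q, p, r, A, B, C, ?_, ⟨hq, hx, hy, hl, hA, hB, hAB, hn1, hn2, hk1, hk2, ?_⟩⟩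
  · have h1 : b ^ k ≤ b ^ (T * k) :=
      pow_le_pow_right₀ (by linarith) (Nat.le_mul_of_pos_left _ hT)
    have h2 : b ^ (T * k) ≤ b ^ (T * k) * max |(A : ℝ)| |(B : ℝ)| := le_mul_of_one_le_right (by positivity) hAB
    have h3 : max ((q : ℝ) ^ i) ((q : ℝ) ^ j) ≤ q := max_le hXq hYq
    have h4 : (q : ℝ) ≤ q * max |(A : ℝ)| |(B : ℝ)| := le_mul_of_one_le_right hqr.le hAB
    have h5 : b ^ k < b ^ (n + 1) := by linarith
    exact Nat.lt_succ_iff.1 ((pow_lt_pow_iff_right₀ (by linarith)).1 h5)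
  · intro q' hq'0 hq' p' r' hcon
    exact hmin q' hq' ⟨hq'0, p', r', hcon⟩

lemma hom_thin (i j : ℝ) (hi : 0 < i) (hj : 0 < j) (hij : i + j = 1) (β : ℕ) (hβ : 9 ≤ β) (τ : ℝ≥0∞)
    (hτ : 0 < τ) : ∃ c > 0, Thin β τ (HB i j c 0)ᶜ := by
  obtain ⟨ε, hε, hετ⟩ := exists_real_le τ hτ
  have hβr : (9 : ℝ) ≤ β := by exact_mod_cast hβ
  obtain ⟨b, hbdef⟩ : ∃ b : ℝ, b = (β : ℝ) ^ 2 := ⟨_, rfl⟩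
  have hb : 2 ≤ b := by nlinarith
  obtain ⟨T, hT, hTi, hTj⟩ : ∃ T : ℕ, 1 ≤ T ∧ 3 ≤ T * i ∧ 3 ≤ T * j := by
    obtain ⟨T1, h1⟩ := exists_nat_ge (3 / i)
    obtain ⟨T2, h2⟩ := exists_nat_ge (3 / j)
    rw [div_le_iff₀ hi] at h1
    rw [div_le_iff₀ hj] at h2
    refine ⟨T1 + T2 + 1, by omega, ?_, ?_⟩ <;> push_cast
    · nlinarith [Nat.cast_nonneg (α := ℝ) T2]
    · nlinarith [Nat.cast_nonneg (α := ℝ) T1]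
  obtain ⟨K, hKdef⟩ : ∃ K : ℝ, K = b ^ (T + 1) := ⟨_, rfl⟩
  have hK : 1 ≤ K := by rw [hKdef]; exact one_le_pow₀ (by linarith)
  obtain ⟨s0, hs0⟩ : ∃ s0 : ℕ, ((β : ℝ)⁻¹) ^ s0 < min (ε / (4 * K)) (1 / (256 * K ^ 5 * b ^ 4)) := by
    apply exists_pow_lt_of_lt_one (by positivity)
    exact inv_lt_one_of_one_lt₀ (by linarith)
  obtain ⟨hs1, hs2⟩ := lt_min_iff.1 hs0
  rw [inv_pow] at hs1 hs2
  rw [lt_div_iff₀ (by positivity)] at hs1 hs2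
  obtain ⟨δ, hδdef⟩ : ∃ δ : ℝ, δ = (b ^ s0)⁻¹ := ⟨_, rfl⟩
  have hδ : 0 < δ := by rw [hδdef]; positivity
  have hδle : δ ≤ ((β : ℝ) ^ s0)⁻¹ := by
    rw [hδdef, hbdef, ← pow_mul]
    gcongr
    · linarith
    · omega
  have hδK : 256 * (b ^ (T + 1)) ^ 5 * b ^ 4 * δ ≤ 1 := by
    rw [← hKdef]
    calc 256 * K ^ 5 * b ^ 4 * δ ≤ 256 * K ^ 5 * b ^ 4 * ((β : ℝ) ^ s0)⁻¹ := by gcongr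
      _ ≤ 1 := by linarith
  refine ⟨δ ^ 2, by positivity, fun m k => {z | s0 ≤ m ∧ ∃ q p r A B C, Dat i j (δ ^ 2) b T (m - s0 + k) k z q p r A B C},
    fun k => 2 * K * ((β : ℝ) ^ s0)⁻¹ * ((β : ℝ) ^ k)⁻¹, fun k => by positivity, ?_, ?_, ?_⟩
  · refine (geom_tsum_le β (2 * K * ((β : ℝ) ^ s0)⁻¹) (by linarith) (by positivity)).trans (le_trans ?_ hετ)
    apply ENNReal.ofReal_le_ofReal
    linarith
  · intro z hz
    obtain ⟨n, k, q, p, r, A, B, C, hkn, hD⟩ := exists_dat i j δ b T hb hT hi hj hij z hz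
    simp only [mem_iUnion, mem_ofPred_eq]
    refine ⟨n - k + s0, k, by omega, q, p, r, A, B, C, ?_⟩
    rw [show n - k + s0 - s0 + k = n by omega]
    exact hD
  · intro m k S hS hclose
    rcases S.eq_empty_or_nonempty with rfl | ⟨z, hz⟩
    · exact ⟨1, 0, 0, by simp, by simp⟩
    obtain ⟨hm, q, p, r, A, B, C, hD⟩ := hS hz
    refine ⟨A, B, C, by linarith [hD.hAB], ?_⟩
    intro z' hz'
    obtain ⟨-, q', p', r', A', B', C', hD'⟩ := hS hz'
    rw [← hbdef] at hclose ⊢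
    have hpow : b ^ (m - s0 + k) * b ^ s0 = b ^ m * b ^ k := by
      rw [← pow_add, ← pow_add]; congr 1; omega
    generalize m - s0 + k = n at *
    have hbn : 0 < b ^ n := by positivity
    have hbm : 0 < b ^ m := by positivity
    have hbk : 0 < b ^ k := by positivity
    have hbs : 0 < b ^ s0 := by positivity
    have hn : b ^ n = δ * (b ^ m * b ^ k) := by
      rw [← hpow, hδdef]; field_simp
    have hcl : ∀ u : ℝ, u ≤ (b ^ m)⁻¹ → u * b ^ n ≤ δ * b ^ k := by
      intro u hu
      calc u * b ^ n ≤ (b ^ m)⁻¹ * b ^ n := by gcongr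
        _ = δ * b ^ k := by rw [hn]; field_simp
    obtain ⟨d1, d2⟩ := hclose z hz z' hz'
    have h0 := dot_zero hb hi hj hij hTi hTj hδ hδK hD hD' (hcl _ d1) (hcl _ d2)
    have hst := hD.strip hb hi hj hij hD' h0
    rw [← hKdef] at hst
    have hM := hD.hAB
    have hmu : (2 * K * ((β : ℝ) ^ s0)⁻¹ * ((β : ℝ) ^ k)⁻¹) ^ 2 = 4 * K ^ 2 * δ * (b ^ k)⁻¹ := by
      rw [hδdef, hbdef, ← pow_mul, ← pow_mul]
      field_simp
      ring
    rw [hmu]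
    refine le_of_mul_le_mul_right (hst.trans ?_) hbn
    have : 4 * K ^ 2 * δ * (b ^ k)⁻¹ * (b ^ m)⁻¹ * max |(A : ℝ)| |(B : ℝ)| * b ^ n
        = 4 * K ^ 2 * δ ^ 2 * max |(A : ℝ)| |(B : ℝ)| := by
      rw [hn]; field_simp
    rw [this]
    gcongr
    norm_num


lemma Thin.mono {β : ℕ} {τ τ' : ℝ≥0∞} {F F' : Set (ℝ × ℝ)} (h : Thin β τ F) (hτ : τ ≤ τ') (hF : F' ⊆ F) :
    Thin β τ' F' := by
  obtain ⟨Y, μ, h1, h2, h3, h4⟩ := h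
  exact ⟨Y, μ, h1, h2.trans hτ, hF.trans h3, h4⟩

lemma inh_coord (i c1 b δ γ x x' q q' p p' N : ℝ) (hb : 2 ≤ b) (hi0 : 0 ≤ i) (hi1 : i ≤ 1)
    (hN : 0 < N) (hc1 : 0 ≤ c1) (hδ : 0 ≤ δ)
    (hq : 0 < q) (hqq : q < q') (hqb : q' ≤ b * q) (hQ : q' * q' ^ i ≤ b * N)
    (hx : |q * x - p - γ| * q ^ i ≤ c1) (hx' : |q' * x' - p' - γ| * q' ^ i ≤ c1)
    (hd : |x - x'| * N ≤ δ) :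
    |(q' - q) * x' - (p' - p)| * (q' - q) ^ i ≤ 2 * b * c1 + b * δ := by
  have hq' : 0 < q' := hq.trans hqq
  have h1 : (q' - q) ^ i ≤ q' ^ i := Real.rpow_le_rpow (by linarith) (by linarith) hi0
  have h2 : q' ^ i ≤ b * q ^ i := rpow_K b q q' i (by linarith) hq.le hq'.le hqb hi0 hi1
  have hX : 0 ≤ q' ^ i := Real.rpow_nonneg hq'.le i
  have e : (q' - q) * x' - (p' - p) = (q' * x' - p' - γ) - (q * x - p - γ) + q * (x - x') := by ring
  have a1 : |(q' - q) * x' - (p' - p)| ≤ |q' * x' - p' - γ| + |q * x - p - γ| + q * |x - x'| := by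
    rw [e]
    have t1 := abs_add_le ((q' * x' - p' - γ) - (q * x - p - γ)) (q * (x - x'))
    have t2 := abs_sub (q' * x' - p' - γ) (q * x - p - γ)
    rw [abs_mul q, abs_of_pos hq] at t1
    linarith
  have a2 : |q * x - p - γ| * q' ^ i ≤ b * c1 := by
    calc |q * x - p - γ| * q' ^ i ≤ |q * x - p - γ| * (b * q ^ i) := by gcongr
      _ = b * (|q * x - p - γ| * q ^ i) := by ring
      _ ≤ _ := by gcongr
  have a3 : (q * |x - x'|) * q' ^ i ≤ b * δ := by
    calc (q * |x - x'|) * q' ^ i ≤ (q' * |x - x'|) * q' ^ i := by gcongr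
      _ = |x - x'| * (q' * q' ^ i) := by ring
      _ ≤ |x - x'| * (b * N) := by gcongr
      _ = b * (|x - x'| * N) := by ring
      _ ≤ _ := by gcongr
  calc |(q' - q) * x' - (p' - p)| * (q' - q) ^ i ≤ |(q' - q) * x' - (p' - p)| * q' ^ i := by gcongr
    _ ≤ (|q' * x' - p' - γ| + |q * x - p - γ| + q * |x - x'|) * q' ^ i := by gcongr
    _ = |q' * x' - p' - γ| * q' ^ i + |q * x - p - γ| * q' ^ i + (q * |x - x'|) * q' ^ i := by ring
    _ ≤ c1 + b * c1 + b * δ := by gcongr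
    _ ≤ _ := by nlinarith

lemma inh_same (i c1 b δ γ x x' q N : ℝ) (p p' : ℤ) (hi0 : 0 ≤ i)
    (hN : 0 < N) (hq : 1 ≤ q) (hQ : q * q ^ i ≤ b * N) (hb : 0 ≤ b)
    (hx : |q * x - p - γ| * q ^ i ≤ c1) (hx' : |q * x' - p' - γ| * q ^ i ≤ c1)
    (hd : |x - x'| * N ≤ δ) (hs : 2 * c1 + b * δ < 1) : p' = p := by
  have hX : 1 ≤ q ^ i := Real.one_le_rpow hq hi0
  have a1 : |q * x - p - γ| ≤ c1 := (le_mul_of_one_le_right (abs_nonneg _) hX).trans hx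
  have a2 : |q * x' - p' - γ| ≤ c1 := (le_mul_of_one_le_right (abs_nonneg _) hX).trans hx'
  have a3 : |q * (x - x')| ≤ b * δ := by
    rw [abs_mul, abs_of_pos (by linarith)]
    calc q * |x - x'| ≤ (q * q ^ i) * |x - x'| := by
          gcongr; exact le_mul_of_one_le_right (by linarith) hX
      _ ≤ (b * N) * |x - x'| := by gcongr
      _ = b * (|x - x'| * N) := by ring
      _ ≤ _ := by gcongr
  have : |((p' - p : ℤ) : ℝ)| < 1 := by
    have e : ((p' - p : ℤ) : ℝ) = (q * x - p - γ) - (q * x' - p' - γ) - q * (x - x') := by push_cast; ring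
    rw [e]
    have t1 := abs_sub ((q * x - p - γ) - (q * x' - p' - γ)) (q * (x - x'))
    have t2 := abs_sub (q * x - p - γ) (q * x' - p' - γ)
    linarith
  have h2 : |p' - p| < 1 := by exact_mod_cast this
  have := Int.abs_lt_one_iff.1 h2
  omega

structure IDat (i j c c1 b : ℝ) (θ : ℝ × ℝ) (n : ℕ) (z : ℝ × ℝ) (q : ℕ) (p r : ℤ) : Prop where
  hz : z ∈ HB i j c 0
  hq : 0 < q
  hx : |(q : ℝ) * z.1 - p - θ.1| * (q : ℝ) ^ i ≤ c1
  hy : |(q : ℝ) * z.2 - r - θ.2| * (q : ℝ) ^ j ≤ c1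
  hn1 : b ^ n ≤ q * max ((q : ℝ) ^ i) ((q : ℝ) ^ j)
  hn2 : q * max ((q : ℝ) ^ i) ((q : ℝ) ^ j) < b ^ (n + 1)

lemma IDat.not_lt {i j c c1 b δ : ℝ} {θ : ℝ × ℝ} {n : ℕ} {z z' : ℝ × ℝ} {q q' : ℕ} {p r p' r' : ℤ}
    (hb : 2 ≤ b) (hi : 0 < i) (hj : 0 < j) (hij : i + j = 1) (hc1 : 0 ≤ c1) (hδ : 0 ≤ δ)
    (hc : 2 * b * c1 + b * δ ≤ c)
    (h : IDat i j c c1 b θ n z q p r) (h' : IDat i j c c1 b θ n z' q' p' r')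
    (hx : |z.1 - z'.1| * b ^ n ≤ δ) (hy : |z.2 - z'.2| * b ^ n ≤ δ) : ¬ q < q' := by
  intro hlt
  have hq : (0 : ℝ) < q := by exact_mod_cast h.hq
  have hltr : (q : ℝ) < q' := by exact_mod_cast hlt
  have hq' : (0 : ℝ) < q' := hq.trans hltr
  have hN : 0 < b ^ n := by positivity
  have hn2 := h'.hn2
  have hn1 := h.hn1
  have hmax : max ((q : ℝ) ^ i) ((q : ℝ) ^ j) ≤ max ((q' : ℝ) ^ i) ((q' : ℝ) ^ j) := by gcongr
  have hm0 : 0 < max ((q : ℝ) ^ i) ((q : ℝ) ^ j) :=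
    lt_of_lt_of_le (Real.rpow_pos_of_pos hq i) (le_max_left _ _)
  have e1 : b ^ (n + 1) = b * b ^ n := by ring
  have hqb : (q' : ℝ) ≤ b * q := by
    by_contra hcon
    push Not at hcon
    have : b * b ^ n ≤ q' * max ((q' : ℝ) ^ i) ((q' : ℝ) ^ j) := by
      calc b * b ^ n ≤ b * (q * max ((q : ℝ) ^ i) ((q : ℝ) ^ j)) := by gcongr
        _ = (b * q) * max ((q : ℝ) ^ i) ((q : ℝ) ^ j) := by ring
        _ ≤ _ := by gcongr
    linarith
  have hQi : (q' : ℝ) * (q' : ℝ) ^ i ≤ b * b ^ n := by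
    rw [← e1]; refine le_trans ?_ hn2.le; gcongr; exact le_max_left _ _
  have hQj : (q' : ℝ) * (q' : ℝ) ^ j ≤ b * b ^ n := by
    rw [← e1]; refine le_trans ?_ hn2.le; gcongr; exact le_max_right _ _
  have c1' := inh_coord i c1 b δ θ.1 z.1 z'.1 q q' p p' (b ^ n) hb hi.le (by linarith) hN hc1 hδ hq hltr hqb hQi
    h.hx h'.hx hx
  have c2' := inh_coord j c1 b δ θ.2 z.2 z'.2 q q' r r' (b ^ n) hb hj.le (by linarith) hN hc1 hδ hq hltr hqb hQj
    h.hy h'.hy hy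
  apply h'.hz (q' - q) (by omega) (p' - p) (r' - r)
  have e : ((q' - q : ℕ) : ℝ) = q' - q := by rw [Nat.cast_sub hlt.le]
  rw [e]
  push_cast
  simp only [Prod.fst_zero, Prod.snd_zero, sub_zero]
  exact ⟨c1'.trans hc, c2'.trans hc⟩

lemma inh_thin (i j c : ℝ) (θ : ℝ × ℝ) (hi : 0 < i) (hj : 0 < j) (hij : i + j = 1) (hc : 0 < c)
    (β : ℕ) (hβ : 9 ≤ β) (τ : ℝ≥0∞) (hτ : 0 < τ) :
    ∃ c1 > 0, Thin β τ (HB i j c 0 ∩ (HB i j c1 θ)ᶜ) := by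
  obtain ⟨ε, hε, hετ⟩ := exists_real_le τ hτ
  have hβr : (9 : ℝ) ≤ β := by exact_mod_cast hβ
  obtain ⟨b, hbdef⟩ : ∃ b : ℝ, b = (β : ℝ) ^ 2 := ⟨_, rfl⟩
  have hb : 2 ≤ b := by nlinarith
  obtain ⟨s1, hs0⟩ : ∃ s1 : ℕ, ((β : ℝ)⁻¹) ^ s1 < min (ε / 2) (min (c / (3 * b)) (1 / (3 * b))) := by
    apply exists_pow_lt_of_lt_one (by positivity)
    exact inv_lt_one_of_one_lt₀ (by linarith)
  obtain ⟨hs1, hs2⟩ := lt_min_iff.1 hs0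
  obtain ⟨hs2, hs3⟩ := lt_min_iff.1 hs2
  rw [inv_pow] at hs1 hs2 hs3
  rw [lt_div_iff₀ (by positivity)] at hs1 hs2 hs3
  obtain ⟨δ, hδdef⟩ : ∃ δ : ℝ, δ = (b ^ s1)⁻¹ := ⟨_, rfl⟩
  have hδ : 0 < δ := by rw [hδdef]; positivity
  have hδle : δ ≤ ((β : ℝ) ^ s1)⁻¹ := by
    rw [hδdef, hbdef, ← pow_mul]
    gcongr
    · linarith
    · omega
  have hδb : δ * (3 * b) ≤ ((β : ℝ) ^ s1)⁻¹ * (3 * b) := by gcongr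
  have hδ1 : δ ≤ 1 := by nlinarith
  have hc1 : δ ^ 2 ≤ δ := pow_le_of_le_one hδ.le hδ1 (by norm_num)
  have hbc1 : b * δ ^ 2 ≤ b * δ := by gcongr
  have hδ2 : 2 * δ ≤ b * δ := by gcongr
  refine ⟨δ ^ 2, by positivity, fun m k => {z | k = 0 ∧ s1 ≤ m ∧ ∃ q p r, IDat i j c (δ ^ 2) b θ (m - s1) z q p r},
    fun k => ((β : ℝ) ^ s1)⁻¹ * ((β : ℝ) ^ k)⁻¹, fun k => by positivity, ?_, ?_, ?_⟩
  · refine (geom_tsum_le β (((β : ℝ) ^ s1)⁻¹) (by linarith) (by positivity)).trans (le_trans ?_ hετ)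
    apply ENNReal.ofReal_le_ofReal
    linarith
  · rintro z ⟨hz, hz1⟩
    have : ∃ q : ℕ, 0 < q ∧ ∃ p r : ℤ, |(q : ℝ) * z.1 - p - θ.1| * (q : ℝ) ^ i ≤ δ ^ 2 ∧
        |(q : ℝ) * z.2 - r - θ.2| * (q : ℝ) ^ j ≤ δ ^ 2 := by
      by_contra hcon
      push Not at hcon
      apply hz1
      intro q hq p r ⟨h1, h2⟩
      exact absurd h2 (not_le.2 (hcon q hq p r h1))
    obtain ⟨q, hq, p, r, hx, hy⟩ := this
    have hq1 : (1 : ℝ) ≤ q := by exact_mod_cast hq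
    obtain ⟨n, hn1, hn2⟩ := exists_nat_pow_near (x := q * max ((q : ℝ) ^ i) ((q : ℝ) ^ j)) (y := b)
      (one_le_mul_of_one_le_of_one_le hq1 (le_max_of_le_left (Real.one_le_rpow hq1 hi.le))) (by linarith)
    simp only [mem_iUnion, mem_ofPred_eq]
    refine ⟨n + s1, 0, rfl, by omega, q, p, r, ?_⟩
    rw [show n + s1 - s1 = n by omega]
    exact ⟨hz, hq, hx, hy, hn1, hn2⟩
  · intro m k S hS hclose
    rcases S.eq_empty_or_nonempty with rfl | ⟨z, hz⟩
    · exact ⟨1, 0, 0, by simp, by simp⟩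
    obtain ⟨rfl, hm, q, p, r, hD⟩ := hS hz
    rw [← hbdef] at hclose ⊢
    have hpow : b ^ (m - s1) * b ^ s1 = b ^ m := by
      rw [← pow_add]; congr 1; omega
    have hD0 : ∀ z' ∈ S, ∃ q p r, IDat i j c (δ ^ 2) b θ (m - s1) z' q p r := fun z' hz' => (hS hz').2.2
    generalize m - s1 = n at *
    have hbn : 0 < b ^ n := by positivity
    have hbm : 0 < b ^ m := by positivity
    have hbs : 0 < b ^ s1 := by positivity
    have hn : b ^ n = δ * b ^ m := by
      rw [← hpow, hδdef]; field_simp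
    have hcl : ∀ u : ℝ, u ≤ (b ^ m)⁻¹ → u * b ^ n ≤ δ := by
      intro u hu
      calc u * b ^ n ≤ (b ^ m)⁻¹ * b ^ n := by gcongr
        _ = δ := by rw [hn]; field_simp
    have hq1 : (1 : ℝ) ≤ q := by exact_mod_cast hD.hq
    have hq0 : (0 : ℝ) < q := by linarith
    have e1 : b ^ (n + 1) = b * b ^ n := by ring
    have key : ∀ z' ∈ S, IDat i j c (δ ^ 2) b θ n z' q p r := by
      intro z' hz'
      obtain ⟨q', p', r', hD'⟩ := hD0 z' hz'
      obtain ⟨d1, d2⟩ := hclose z hz z' hz'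
      obtain ⟨d3, d4⟩ := hclose z' hz' z hz
      have n1 := IDat.not_lt hb hi hj hij (sq_nonneg δ) hδ.le (by linarith) hD hD' (hcl _ d1) (hcl _ d2)
      have n2 := IDat.not_lt hb hi hj hij (sq_nonneg δ) hδ.le (by linarith) hD' hD (hcl _ d3) (hcl _ d4)
      have hqq : q' = q := by omega
      subst hqq
      have hQi : (q' : ℝ) * (q' : ℝ) ^ i ≤ b * b ^ n := by
        rw [← e1]; refine le_trans ?_ hD.hn2.le; gcongr; exact le_max_left _ _
      have hQj : (q' : ℝ) * (q' : ℝ) ^ j ≤ b * b ^ n := by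
        rw [← e1]; refine le_trans ?_ hD.hn2.le; gcongr; exact le_max_right _ _
      have hpp : p' = p := inh_same i (δ ^ 2) b δ θ.1 z.1 z'.1 q' (b ^ n) p p' hi.le hbn hq1 hQi (by linarith)
        hD.hx hD'.hx (hcl _ d1) (by linarith)
      have hrr : r' = r := inh_same j (δ ^ 2) b δ θ.2 z.2 z'.2 q' (b ^ n) r r' hj.le hbn hq1 hQj (by linarith)
        hD.hy hD'.hy (hcl _ d2) (by linarith)
      rw [hpp, hrr] at hD'
      exact hD'
    have hmu : (((β : ℝ) ^ s1)⁻¹ * ((β : ℝ) ^ 0)⁻¹) ^ 2 = δ := by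
      rw [hδdef, hbdef, ← pow_mul]
      field_simp
      ring
    have fin : ∀ (x p γ X : ℝ), |q * x - p - γ| * X ≤ δ ^ 2 → b ^ n ≤ q * X →
        |x - (p + γ) / q| ≤ δ * (b ^ m)⁻¹ := by
      intro x p γ X h1 h2
      have e : x - (p + γ) / q = (q * x - p - γ) / q := by field_simp; ring
      have h3 : |x - (p + γ) / q| * b ^ n ≤ δ ^ 2 := by
        rw [e, abs_div, abs_of_pos hq0]
        calc |q * x - p - γ| / q * b ^ n ≤ |q * x - p - γ| / q * (q * X) := by gcongr
          _ = |q * x - p - γ| * X := by field_simp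
          _ ≤ _ := h1
      refine le_of_mul_le_mul_right (h3.trans (le_of_eq ?_)) hbn
      rw [hn]; field_simp
    rw [hmu]
    rcases le_total ((q : ℝ) ^ j) ((q : ℝ) ^ i) with hij' | hij'
    · refine ⟨1, 0, -((p + θ.1) / q), by simp, ?_⟩
      intro z' hz'
      have hD' := key z' hz'
      have hn1 := hD'.hn1
      rw [max_eq_left hij'] at hn1
      have := fin _ _ _ _ hD'.hx hn1
      rw [show (1 : ℝ) * z'.1 + 0 * z'.2 + -((p + θ.1) / q) = z'.1 - (p + θ.1) / q by ring]
      simpa using this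
    · refine ⟨0, 1, -((r + θ.2) / q), by simp, ?_⟩
      intro z' hz'
      have hD' := key z' hz'
      have hn1 := hD'.hn1
      rw [max_eq_right hij'] at hn1
      have := fin _ _ _ _ hD'.hy hn1
      rw [show (0 : ℝ) * z'.1 + 1 * z'.2 + -((r + θ.2) / q) = z'.2 - (r + θ.2) / q by ring]
      simpa using this


lemma HB_subset_badPair (i j c : ℝ) (θ : ℝ × ℝ) (hi : 0 < i) (hj : 0 < j) (hc : 0 < c) :
    HB i j c θ ⊆ badPair i j θ := by
  intro z hz
  have aux : ∀ (e : ℝ) (q : ℕ) (d : ℝ), 0 < e → 0 < q → c < d * (q : ℝ) ^ e →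
      c ^ (1 / e) / q < d ^ (1 / e) := by
    intro e q d he hq h
    have hqr : (0 : ℝ) < q := by exact_mod_cast hq
    have hX : 0 < (q : ℝ) ^ e := Real.rpow_pos_of_pos hqr e
    have h1 : c / (q : ℝ) ^ e < d := by rwa [div_lt_iff₀ hX]
    have h2 : (c / (q : ℝ) ^ e) ^ (1 / e) < d ^ (1 / e) :=
      Real.rpow_lt_rpow (by positivity) h1 (by positivity)
    rwa [Real.div_rpow hc.le hX.le, ← Real.rpow_mul hqr.le, mul_one_div_cancel he.ne', Real.rpow_one] at h2
  refine ⟨min (c ^ (1 / i)) (c ^ (1 / j)),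
    lt_min (Real.rpow_pos_of_pos hc _) (Real.rpow_pos_of_pos hc _), ?_⟩
  intro q hq
  have hqr : (0 : ℝ) < q := by exact_mod_cast hq
  have h := hz q hq (round ((q : ℝ) * z.1 - θ.1)) (round ((q : ℝ) * z.2 - θ.2))
  rw [not_and_or, not_le, not_le] at h
  rcases h with h | h
  · apply lt_max_of_lt_left
    rw [sub_right_comm] at h
    refine lt_of_le_of_lt ?_ (aux i q _ hi hq h)
    gcongr
    exact min_le_left _ _
  · apply lt_max_of_lt_right
    rw [sub_right_comm] at h
    refine lt_of_le_of_lt ?_ (aux j q _ hj hq h)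
    gcongr
    exact min_le_right _ _

lemma badPair_thin (i j : ℝ) (θ : ℝ × ℝ) (hi : 0 < i) (hj : 0 < j) (hij : i + j = 1)
    (β : ℕ) (hβ : 9 ≤ β) (τ : ℝ≥0∞) (hτ : 0 < τ) : Thin β τ (badPair i j θ)ᶜ := by
  obtain ⟨ε, hε, hsum⟩ := ENNReal.exists_pos_sum_of_countable' hτ.ne' ℕ
  obtain ⟨c, hc, hT0⟩ := hom_thin i j hi hj hij β hβ (ε 0) (hε 0)
  have hinh := fun n : ℕ => inh_thin i j c θ hi hj hij hc β hβ (ε (n + 1)) (hε (n + 1))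
  choose c1 hc1 hT1 using hinh
  let F : ℕ → Set (ℝ × ℝ) := fun n => Nat.casesOn n (HB i j c 0)ᶜ (fun n => HB i j c 0 ∩ (HB i j (c1 n) θ)ᶜ)
  have hF : ∀ n, Thin β (ε n) (F n) := by
    intro n
    cases n with
    | zero => exact hT0
    | succ n => exact hT1 n
  refine (Thin.iUnion hF).mono hsum.le ?_
  intro z hz
  rw [mem_iUnion]
  by_cases h : z ∈ HB i j c 0
  · exact ⟨1, h, fun h2 => hz (HB_subset_badPair i j _ θ hi hj (hc1 0) h2)⟩
  · exact ⟨0, h⟩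

end Aux

theorem stmt6 (i j : ℕ → ℝ) (θ : ℕ → ℝ × ℝ)
    (hi0 : ∀ t, 0 < i t) (hi1 : ∀ t, i t < 1)
    (hj0 : ∀ t, 0 < j t) (hj1 : ∀ t, j t < 1)
    (hij : ∀ t, i t + j t = 1) :
    dimH (⋂ t : ℕ, badPair (i t) (j t) (θ t)) = 2 := by
  apply le_antisymm
  · refine (dimH_mono (subset_univ _)).trans ?_
    rw [Real.dimH_univ_eq_finrank]
    simp
  · have key : ∀ s : NNReal, 0 < s → s < 2 → (s : ENNReal) ≤ dimH (⋂ t : ℕ, badPair (i t) (j t) (θ t)) := by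
      intro s hs0 hs2
      apply dim_ge s hs0 hs2
      intro β hβ τ hτ
      obtain ⟨ε, hε, hsum⟩ := ENNReal.exists_pos_sum_of_countable' hτ.ne' ℕ
      rw [compl_iInter]
      exact (Thin.iUnion fun t => badPair_thin (i t) (j t) (θ t) (hi0 t) (hj0 t) (hij t) β hβ (ε t) (hε t)).mono
        hsum.le subset_rfl
    apply le_of_forall_lt
    intro a ha
    obtain ⟨s, h1, h2⟩ := ENNReal.lt_iff_exists_nnreal_btwn.1 ha
    refine h1.trans_le (key s ?_ (by exact_mod_cast h2))
    have : (0 : ENNReal) < s := lt_of_le_of_lt (zero_le) h1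
    exact_mod_cast this
end

section
/- Let i and j be real numbers with 0 < j ≤ i < 1 and i + j = 1, let κ > 1 and c > 0, let I ⊆ ℝ be a compact interval, and let f : ℝ → ℝ be twice continuously differentiable on I with |f′(x)| ≤ κ − 1 and κ^{-1} ≤ |f″(x)| ≤ κ for all x ∈ I. Let q be a positive integer and p, r ∈ ℤ with p/q ∈ I and |f(p/q) − r/q| < κ c / q^{1+j}. Let A, B, C ∈ ℤ with (A, B) ≠ (0, 0), A p + B r + C q = 0, |A| ≤ q^i and |B| ≤ q^j. Define F(x) := A x + B f(x) + C, E := A + B f′(p/q), H := max{ q|E|, 3κ√(c q |B|) }, and Θ := { x ∈ I : |F(x)| < 2κ c / q }. If q E² < 9 κ² c |B|, then Θ is contained in a single open interval of length at most 42 κ³ c / H; otherwise, Θ is contained in the union of at most two open intervals each of length at most 42 κ³ c / H. -/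
open Set

lemma aux_mono (a b : ℝ) (F G : ℝ → ℝ) (hab : a ≤ b)
    (h : ∀ z ∈ Icc a b, HasDerivWithinAt F (G z) (Icc a b) z)
    (hG : ∀ z ∈ Icc a b, 0 ≤ G z) : F a ≤ F b := by
  have hm : MonotoneOn F (Icc a b) := by
    apply monotoneOn_of_hasDerivWithinAt_nonneg (convex_Icc a b) (f' := G)
    · exact fun z hz => (h z hz).continuousWithinAt
    · exact fun z hz => (h z (interior_subset hz)).mono interior_subset
    · exact fun z hz => hG z (interior_subset hz)
  exact hm (left_mem_Icc.2 hab) (right_mem_Icc.2 hab) hab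

lemma aux_grow (a b l : ℝ) (F G : ℝ → ℝ) (hab : a ≤ b)
    (h : ∀ z ∈ Icc a b, HasDerivWithinAt F (G z) (Icc a b) z)
    (hG : ∀ z ∈ Icc a b, l ≤ G z) : l * (b - a) ≤ F b - F a := by
  have := aux_mono a b (fun z => F z - l * z) (fun z => G z - l * 1) hab
    (fun z hz => (h z hz).sub ((hasDerivWithinAt_id z _).const_mul l))
    (fun z hz => by have := hG z hz; linarith)
  linarith

lemma aux_restrict {F G : ℝ → ℝ} {a b c d : ℝ} (hc : c ∈ Icc a b) (hd : d ∈ Icc a b)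
    (h : ∀ z ∈ Icc a b, HasDerivWithinAt F (G z) (Icc a b) z) :
    ∀ z ∈ Icc c d, HasDerivWithinAt F (G z) (Icc c d) z := fun z hz =>
  (h z (Icc_subset_Icc hc.1 hd.2 hz)).mono (Icc_subset_Icc hc.1 hd.2)

lemma aux_taylor (a b l : ℝ) (F G K : ℝ → ℝ)
    (h : ∀ z ∈ Icc a b, HasDerivWithinAt F (G z) (Icc a b) z)
    (h' : ∀ z ∈ Icc a b, HasDerivWithinAt G (K z) (Icc a b) z)
    (hK : ∀ z ∈ Icc a b, l ≤ K z) (x y : ℝ) (hx : x ∈ Icc a b) (hy : y ∈ Icc a b) :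
    l / 2 * (y - x) ^ 2 ≤ F y - F x - G x * (y - x) := by
  have hd : ∀ s : Set ℝ, ∀ z, HasDerivWithinAt (fun z => G x * z + l / 2 * (z - x) ^ 2)
      (G x + l * (z - x)) s z := by
    intro s z
    have h1 := ((hasDerivAt_id z).const_mul (G x)).add
      ((((hasDerivAt_id z).sub_const x).pow 2).const_mul (l / 2))
    have h2 := h1.hasDerivWithinAt (s := s)
    refine h2.congr_deriv ?_
    simp only [id]
    push_cast
    ring
  rcases le_total x y with hxy | hxy
  · have := aux_mono x y (fun z => F z - (G x * z + l / 2 * (z - x) ^ 2))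
      (fun z => G z - (G x + l * (z - x))) hxy
      (fun z hz => (aux_restrict hx hy h z hz).sub (hd _ z))
      (fun z hz => by
        have hzI : z ∈ Icc a b := ⟨hx.1.trans hz.1, hz.2.trans hy.2⟩
        have := aux_grow x z l G K hz.1 (aux_restrict hx hzI h')
          (fun w hw => hK w (Icc_subset_Icc hx.1 hzI.2 hw))
        linarith)
    linarith
  · have := aux_mono y x (fun z => (G x * z + l / 2 * (z - x) ^ 2) - F z)
      (fun z => (G x + l * (z - x)) - G z) hxy
      (fun z hz => (hd _ z).sub (aux_restrict hy hx h z hz))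
      (fun z hz => by
        have hzI : z ∈ Icc a b := ⟨hy.1.trans hz.1, hz.2.trans hx.2⟩
        have := aux_grow z x l G K hz.2 (aux_restrict hzI hx h')
          (fun w hw => hK w (Icc_subset_Icc hzI.1 hx.2 hw))
        linarith)
    linarith

lemma aux_lin (a b t : ℝ) (F G K : ℝ → ℝ) 
    (h : ∀ z ∈ Icc a b, HasDerivWithinAt F (G z) (Icc a b) z)
    (h' : ∀ z ∈ Icc a b, HasDerivWithinAt G (K z) (Icc a b) z) :
    ∀ z ∈ Icc a b, HasDerivWithinAt (fun z => 2 * t * F z - G z ^ 2)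
      (2 * G z * (t - K z)) (Icc a b) z := by
  intro z hz
  refine (((h z hz).const_mul (2 * t)).sub ((h' z hz).pow 2)).congr_deriv ?_
  push_cast
  ring

lemma aux_M (a b l u : ℝ) (F G K : ℝ → ℝ) (hab : a ≤ b)
    (h : ∀ z ∈ Icc a b, HasDerivWithinAt F (G z) (Icc a b) z)
    (h' : ∀ z ∈ Icc a b, HasDerivWithinAt G (K z) (Icc a b) z)
    (hG : ∀ z ∈ Icc a b, 0 ≤ G z)
    (hK : ∀ z ∈ Icc a b, l ≤ K z ∧ K z ≤ u) :
    2 * l * (F b - F a) ≤ G b ^ 2 - G a ^ 2 ∧ G b ^ 2 - G a ^ 2 ≤ 2 * u * (F b - F a) := by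
  constructor
  · have := aux_mono a b _ _ hab (fun z hz => (aux_lin a b l F G K h h' z hz).neg)
      (fun z hz => by nlinarith [mul_nonneg (hG z hz) (sub_nonneg.2 (hK z hz).1)])
    simp only [Pi.neg_apply] at this
    linarith
  · have := aux_mono a b _ _ hab (fun z hz => (aux_lin a b u F G K h h' z hz))
      (fun z hz => by nlinarith [mul_nonneg (hG z hz) (sub_nonneg.2 (hK z hz).2)])
    linarith

lemma aux_M' (a b l u : ℝ) (F G K : ℝ → ℝ) (hab : a ≤ b)
    (h : ∀ z ∈ Icc a b, HasDerivWithinAt F (G z) (Icc a b) z)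
    (h' : ∀ z ∈ Icc a b, HasDerivWithinAt G (K z) (Icc a b) z)
    (hG : ∀ z ∈ Icc a b, G z ≤ 0)
    (hK : ∀ z ∈ Icc a b, l ≤ K z ∧ K z ≤ u) :
    2 * l * (F a - F b) ≤ G a ^ 2 - G b ^ 2 ∧ G a ^ 2 - G b ^ 2 ≤ 2 * u * (F a - F b) := by
  constructor
  · have := aux_mono a b _ _ hab (fun z hz => (aux_lin a b l F G K h h' z hz))
      (fun z hz => by nlinarith [mul_nonneg (neg_nonneg.2 (hG z hz)) (sub_nonneg.2 (hK z hz).1)])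
    linarith
  · have := aux_mono a b _ _ hab (fun z hz => (aux_lin a b u F G K h h' z hz).neg)
      (fun z hz => by nlinarith [mul_nonneg (neg_nonneg.2 (hG z hz)) (sub_nonneg.2 (hK z hz).2)])
    simp only [Pi.neg_apply] at this
    linarith

lemma aux_alg (l u δ E g P0 P m : ℝ) (hl : 0 < l) (hu : 0 < u)
    (hE : 9 * u * δ ≤ E ^ 2) (hF : P0 - P ≤ 3 * δ)
    (h1 : E ^ 2 ≤ 2 * u * (P0 - m)) (h2 : 2 * l * (P - m) ≤ g ^ 2) :
    l * E ^ 2 ≤ 3 * u * g ^ 2 := by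
  have h3 : u * (2 * l * (P - m)) ≤ u * g ^ 2 := mul_le_mul_of_nonneg_left h2 hu.le
  have h4 : l * E ^ 2 ≤ l * (2 * u * (P0 - m)) := mul_le_mul_of_nonneg_left h1 hl.le
  have h5 : l * (9 * u * δ) ≤ l * E ^ 2 := mul_le_mul_of_nonneg_left hE hl.le
  have h6 : (l * u) * (P0 - P) ≤ (l * u) * (3 * δ) := mul_le_mul_of_nonneg_left hF (by positivity)
  nlinarith

lemma aux_core (a b l u δ : ℝ) (F G K : ℝ → ℝ) (hl : 0 < l) (hlu : l ≤ u) 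
    (h : ∀ z ∈ Icc a b, HasDerivWithinAt F (G z) (Icc a b) z)
    (h' : ∀ z ∈ Icc a b, HasDerivWithinAt G (K z) (Icc a b) z)
    (hK : ∀ z ∈ Icc a b, l ≤ K z ∧ K z ≤ u)
    (x₀ x : ℝ) (hx₀ : x₀ ∈ Icc a b) (hx : x ∈ Icc a b)
    (hE : 9 * u * δ ≤ G x₀ ^ 2) (hF : F x₀ - F x ≤ 3 * δ) :
    l * G x₀ ^ 2 ≤ 3 * u * G x ^ 2 := by
  have hu : 0 < u := hl.trans_le hlu
  have easy : G x₀ ^ 2 ≤ 3 * G x ^ 2 → l * G x₀ ^ 2 ≤ 3 * u * G x ^ 2 := by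
    intro hh
    nlinarith [mul_le_mul_of_nonneg_left hh hl.le, mul_nonneg (sub_nonneg.2 hlu) (sq_nonneg (G x))]
  have hmono : ∀ y z, y ∈ Icc a b → z ∈ Icc a b → y ≤ z → G y ≤ G z := fun y z hy hz hyz =>
    aux_mono y z G K hyz (aux_restrict hy hz h')
      (fun w hw => hl.le.trans (hK w (Icc_subset_Icc hy.1 hz.2 hw)).1)
  have hcont : ContinuousOn G (Icc a b) := fun z hz => (h' z hz).continuousWithinAt
  have useM : ∀ y z, y ∈ Icc a b → z ∈ Icc a b → y ≤ z → 0 ≤ G y → 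
      2 * l * (F z - F y) ≤ G z ^ 2 - G y ^ 2 ∧ G z ^ 2 - G y ^ 2 ≤ 2 * u * (F z - F y) := by
    intro y z hy hz hyz h0
    exact aux_M y z l u F G K hyz (aux_restrict hy hz h) (aux_restrict hy hz h')
      (fun w hw => h0.trans (hmono y w hy (Icc_subset_Icc hy.1 hz.2 hw) hw.1))
      (fun w hw => hK w (Icc_subset_Icc hy.1 hz.2 hw))
  have useM' : ∀ y z, y ∈ Icc a b → z ∈ Icc a b → y ≤ z → G z ≤ 0 → 
      2 * l * (F y - F z) ≤ G y ^ 2 - G z ^ 2 ∧ G y ^ 2 - G z ^ 2 ≤ 2 * u * (F y - F z) := by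
    intro y z hy hz hyz h0
    exact aux_M' y z l u F G K hyz (aux_restrict hy hz h) (aux_restrict hy hz h')
      (fun w hw => (hmono w z (Icc_subset_Icc hy.1 hz.2 hw) hz hw.2).trans h0)
      (fun w hw => hK w (Icc_subset_Icc hy.1 hz.2 hw))
  have hFu : u * (F x₀ - F x) ≤ u * (3 * δ) := mul_le_mul_of_nonneg_left hF hu.le
  rcases le_total 0 (G x₀) with h0 | h0
  · rcases le_total x₀ x with hxx | hxx
    · have := hmono x₀ x hx₀ hx hxx
      exact easy (by nlinarith)
    · rcases le_total 0 (G x) with h1 | h1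
      · have := (useM x x₀ hx hx₀ hxx h1).2
        exact easy (by nlinarith)
      · obtain ⟨m, hm, hm0⟩ := intermediate_value_Icc hxx
          (hcont.mono (Icc_subset_Icc hx.1 hx₀.2)) (show (0:ℝ) ∈ Icc (G x) (G x₀) from ⟨h1, h0⟩)
        have hmI := Icc_subset_Icc hx.1 hx₀.2 hm
        have e1 := (useM m x₀ hmI hx₀ hm.2 hm0.ge).2
        have e2 := (useM' x m hx hmI hm.1 hm0.le).1
        rw [hm0] at e1 e2
        exact aux_alg l u δ (G x₀) (G x) (F x₀) (F x) (F m) hl hu hE hF (by linarith) (by linarith)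
  · rcases le_total x x₀ with hxx | hxx
    · have := hmono x x₀ hx hx₀ hxx
      exact easy (by nlinarith)
    · rcases le_total (G x) 0 with h1 | h1
      · have := (useM' x₀ x hx₀ hx hxx h1).2
        exact easy (by nlinarith)
      · obtain ⟨m, hm, hm0⟩ := intermediate_value_Icc hxx
          (hcont.mono (Icc_subset_Icc hx₀.1 hx.2)) (show (0:ℝ) ∈ Icc (G x₀) (G x) from ⟨h0, h1⟩)
        have hmI := Icc_subset_Icc hx₀.1 hx.2 hm
        have e1 := (useM' x₀ m hx₀ hmI hm.1 hm0.le).2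
        have e2 := (useM m x hmI hx hm.2 hm0.ge).1
        rw [hm0] at e1 e2
        exact aux_alg l u δ (G x₀) (G x) (F x₀) (F x) (F m) hl hu hE hF (by linarith) (by linarith)

/-- A set of pairwise distance less than `D` lies in an open interval of length `2 D`. -/
lemma aux_set (S : Set ℝ) (D L : ℝ) (hL : 0 ≤ L) (hDL : 2 * D ≤ L)
    (h : ∀ x ∈ S, ∀ y ∈ S, x ≤ y → y - x < D) : ∃ u v : ℝ, v - u ≤ L ∧ S ⊆ Ioo u v := by
  rcases S.eq_empty_or_nonempty with rfl | ⟨w, hw⟩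
  · exact ⟨0, 0, by simpa using hL, empty_subset _⟩
  · refine ⟨w - D, w + D, by linarith, fun x hx => ?_⟩
    have hD := h w hw w hw le_rfl
    rcases le_total x w with hxw | hxw
    · have := h x hx w hw hxw
      constructor <;> linarith
    · have := h w hw x hx hxw
      constructor <;> linarith

/-- The two-interval case. -/
lemma aux_two (a b l u δ g L : ℝ) (F G K : ℝ → ℝ) (hl : 0 < l) (hlu : l ≤ u) 
    (h : ∀ z ∈ Icc a b, HasDerivWithinAt F (G z) (Icc a b) z)
    (h' : ∀ z ∈ Icc a b, HasDerivWithinAt G (K z) (Icc a b) z)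
    (hK : ∀ z ∈ Icc a b, l ≤ K z ∧ K z ≤ u)
    (x₀ : ℝ) (hx₀ : x₀ ∈ Icc a b) (hFx₀ : |F x₀| ≤ δ)
    (hE : 9 * u * δ ≤ G x₀ ^ 2) (hg : 0 < g) (hgE : 3 * u * g ^ 2 ≤ l * G x₀ ^ 2)
    (hL : 8 * δ / g ≤ L) :
    ∃ u₁ v₁ u₂ v₂ : ℝ, v₁ - u₁ ≤ L ∧ v₂ - u₂ ≤ L ∧
      {x ∈ Icc a b | |F x| < 2 * δ} ⊆ Ioo u₁ v₁ ∪ Ioo u₂ v₂ := by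
  have hu : 0 < u := hl.trans_le hlu
  have hδ : 0 ≤ δ := (abs_nonneg _).trans hFx₀
  have hL0 : 0 ≤ L := le_trans (by positivity) hL
  have hDL : 2 * (4 * δ / g) ≤ L := by
    have : 2 * (4 * δ / g) = 8 * δ / g := by ring
    linarith
  have hmono : ∀ y z, y ∈ Icc a b → z ∈ Icc a b → y ≤ z → G y ≤ G z := fun y z hy hz hyz =>
    aux_mono y z G K hyz (aux_restrict hy hz h')
      (fun w hw => hl.le.trans (hK w (Icc_subset_Icc hy.1 hz.2 hw)).1)
  have hbig : ∀ x ∈ Icc a b, |F x| < 2 * δ → g ≤ |G x| := by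
    intro x hx hFx
    have := aux_core a b l u δ F G K hl hlu h h' hK x₀ x hx₀ hx hE
      (by linarith [(abs_le.1 hFx₀).2, (abs_lt.1 hFx).1])
    have h2 : g ^ 2 ≤ G x ^ 2 := by
      by_contra hcon
      push Not at hcon
      nlinarith [mul_lt_mul_of_pos_left hcon hu]
    have := sq_le_sq.1 h2
    rwa [abs_of_pos hg] at this
  obtain ⟨u₁, v₁, hl1, hs1⟩ := aux_set {x | x ∈ Icc a b ∧ |F x| < 2 * δ ∧ 0 ≤ G x} (4 * δ / g) L hL0 hDL (by
    rintro x ⟨hx, hFx, hGx⟩ y ⟨hy, hFy, hGy⟩ hxy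
    have e := hbig x hx hFx
    rw [abs_of_nonneg hGx] at e
    have := aux_grow x y g F G hxy (aux_restrict hx hy h)
      (fun z hz => e.trans (hmono x z hx (Icc_subset_Icc hx.1 hy.2 hz) hz.1))
    rw [lt_div_iff₀ hg]
    linarith [(abs_lt.1 hFx).1, (abs_lt.1 hFy).2])
  obtain ⟨u₂, v₂, hl2, hs2⟩ := aux_set {x | x ∈ Icc a b ∧ |F x| < 2 * δ ∧ G x ≤ 0} (4 * δ / g) L hL0 hDL (by
    rintro x ⟨hx, hFx, hGx⟩ y ⟨hy, hFy, hGy⟩ hxy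
    have e := hbig y hy hFy
    rw [abs_of_nonpos hGy] at e
    have := aux_grow x y g (fun z => - F z) (fun z => - G z) hxy
      (fun z hz => (aux_restrict hx hy h z hz).neg)
      (fun z hz => e.trans (neg_le_neg (hmono z y (Icc_subset_Icc hx.1 hy.2 hz) hy hz.2)))
    rw [lt_div_iff₀ hg]
    linarith [(abs_lt.1 hFx).2, (abs_lt.1 hFy).1])
  refine ⟨u₁, v₁, u₂, v₂, hl1, hl2, ?_⟩
  rintro x ⟨hx, hFx⟩
  rcases le_total 0 (G x) with h0 | h0
  · exact Or.inl (hs1 ⟨hx, hFx, h0⟩)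
  · exact Or.inr (hs2 ⟨hx, hFx, h0⟩)

lemma aux_sign (a b : ℝ) (k : ℝ → ℝ) (hk : ContinuousOn k (Icc a b))
    (h0 : ∀ x ∈ Icc a b, k x ≠ 0) (B : ℝ) :
    ∃ s : ℝ, |s| = 1 ∧ ∀ x ∈ Icc a b, s * (B * k x) = |B| * |k x| := by
  have key : (∀ x ∈ Icc a b, 0 ≤ k x) ∨ (∀ x ∈ Icc a b, k x ≤ 0) := by
    by_contra hcon
    push Not at hcon
    obtain ⟨⟨x, hx, hx0⟩, y, hy, hy0⟩ := hcon
    obtain ⟨m, hm, hm0⟩ := isPreconnected_Icc.intermediate_value hx hy hk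
      (show (0:ℝ) ∈ Icc (k x) (k y) from ⟨hx0.le, hy0.le⟩)
    exact h0 m hm hm0
  rcases key with hk0 | hk0 <;> rcases le_total 0 B with hB | hB
  · exact ⟨1, by simp, fun x hx => by rw [abs_of_nonneg hB, abs_of_nonneg (hk0 x hx)]; ring⟩
  · exact ⟨-1, by simp, fun x hx => by rw [abs_of_nonpos hB, abs_of_nonneg (hk0 x hx)]; ring⟩
  · exact ⟨-1, by simp, fun x hx => by rw [abs_of_nonneg hB, abs_of_nonpos (hk0 x hx)]; ring⟩
  · exact ⟨1, by simp, fun x hx => by rw [abs_of_nonpos hB, abs_of_nonpos (hk0 x hx)]; ring⟩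


set_option maxHeartbeats 1000000 in
theorem stmt17 (i j κ c a₁ a₂ : ℝ) (f f' f'' : ℝ → ℝ)
    (hj0 : 0 < j) (hji : j ≤ i) (hi1 : i < 1) (hij : i + j = 1)
    (hκ : 1 < κ) (hc : 0 < c)
    -- `f` is twice continuously differentiable on the compact interval `I = [a₁, a₂]`,
    -- with first derivative `f'` and second derivative `f''`
    (hf : ∀ x ∈ Set.Icc a₁ a₂, HasDerivWithinAt f (f' x) (Set.Icc a₁ a₂) x)
    (hf' : ∀ x ∈ Set.Icc a₁ a₂, HasDerivWithinAt f' (f'' x) (Set.Icc a₁ a₂) x)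
    (hf''cont : ContinuousOn f'' (Set.Icc a₁ a₂))
    (hder : ∀ x ∈ Set.Icc a₁ a₂, |f' x| ≤ κ - 1)
    (hder2 : ∀ x ∈ Set.Icc a₁ a₂, κ⁻¹ ≤ |f'' x| ∧ |f'' x| ≤ κ)
    (q : ℕ) (hq : 0 < q) (p r : ℤ)
    (hpq : (p : ℝ) / q ∈ Set.Icc a₁ a₂)
    (hfr : |f ((p : ℝ) / q) - (r : ℝ) / q| < κ * c / (q : ℝ) ^ (1 + j))
    (A B C : ℤ) (hAB : (A, B) ≠ (0, 0)) (hABC : A * p + B * r + C * q = 0)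
    (hA : (|A| : ℝ) ≤ (q : ℝ) ^ i) (hB : (|B| : ℝ) ≤ (q : ℝ) ^ j)
    (F : ℝ → ℝ) (hF : ∀ x, F x = (A : ℝ) * x + (B : ℝ) * f x + (C : ℝ))
    (E H : ℝ) (hE : E = (A : ℝ) + (B : ℝ) * f' ((p : ℝ) / q))
    (hH : H = max ((q : ℝ) * |E|) (3 * κ * Real.sqrt (c * q * (|B| : ℝ))))
    (Θ : Set ℝ) (hΘ : Θ = {x ∈ Set.Icc a₁ a₂ | |F x| < 2 * κ * c / q}) :
    if (q : ℝ) * E ^ 2 < 9 * κ ^ 2 * c * (|B| : ℝ) then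
      ∃ u v : ℝ, v - u ≤ 42 * κ ^ 3 * c / H ∧ Θ ⊆ Set.Ioo u v
    else
      ∃ u₁ v₁ u₂ v₂ : ℝ, v₁ - u₁ ≤ 42 * κ ^ 3 * c / H ∧ v₂ - u₂ ≤ 42 * κ ^ 3 * c / H ∧
        Θ ⊆ Set.Ioo u₁ v₁ ∪ Set.Ioo u₂ v₂ := by
  have hQ : (0:ℝ) < q := by exact_mod_cast hq
  have hκ0 : 0 < κ := by linarith
  have hb0 : (0:ℝ) ≤ |(B:ℝ)| := abs_nonneg _
  set x₀ : ℝ := (p : ℝ) / q with hx₀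
  set δ : ℝ := κ * c / q with hδdef
  have hδ : 0 < δ := by positivity
  have hΘ' : Θ = {x ∈ Set.Icc a₁ a₂ | |F x| < 2 * δ} := by
    rw [hΘ, hδdef]
    have : 2 * κ * c / (q:ℝ) = 2 * (κ * c / q) := by ring
    rw [this]
  have hFx₀ : |F x₀| ≤ δ := by
    have hABC' : (A:ℝ) * p + B * r + C * q = 0 := by exact_mod_cast hABC
    have e : F x₀ = B * (f x₀ - r / q) := by
      rw [hF]
      have : (A:ℝ) * x₀ + C = - (B * (r / q)) := by
        rw [hx₀]
        field_simp
        linarith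
      linarith
    rw [e, abs_mul]
    have hpow : (q:ℝ) ^ (1 + j) = q * (q:ℝ) ^ j := by
      rw [Real.rpow_add hQ, Real.rpow_one]
    have hqj : 0 < (q:ℝ) ^ j := Real.rpow_pos_of_pos hQ _
    calc |(B:ℝ)| * |f x₀ - r / q| ≤ (q:ℝ) ^ j * (κ * c / (q : ℝ) ^ (1 + j)) :=
          mul_le_mul hB hfr.le (abs_nonneg _) hqj.le
      _ = δ := by rw [hpow, hδdef]; field_simp
  have hFd : ∀ z ∈ Icc a₁ a₂, HasDerivWithinAt F ((A:ℝ) + B * f' z) (Icc a₁ a₂) z := by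
    intro z hz
    have e : F = fun x => (A : ℝ) * x + (B : ℝ) * f x + (C : ℝ) := funext hF
    rw [e]
    have := ((((hasDerivWithinAt_id z (Icc a₁ a₂)).const_mul (A:ℝ)).add
      ((hf z hz).const_mul (B:ℝ))).add_const (C:ℝ))
    simpa using this
  have hGd : ∀ z ∈ Icc a₁ a₂, HasDerivWithinAt (fun z => (A:ℝ) + B * f' z) (B * f'' z) (Icc a₁ a₂) z :=
    fun z hz => ((hf' z hz).const_mul (B:ℝ)).const_add (A:ℝ)
  obtain ⟨s, hs, hsB⟩ := aux_sign a₁ a₂ f'' hf''cont (fun x hx h0 => by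
    have := (hder2 x hx).1
    rw [h0, abs_zero] at this
    exact absurd this (not_le.2 (by positivity))) B
  have hsFd : ∀ z ∈ Icc a₁ a₂, HasDerivWithinAt (fun z => s * F z) (s * ((A:ℝ) + B * f' z)) (Icc a₁ a₂) z :=
    fun z hz => (hFd z hz).const_mul s
  have hsGd : ∀ z ∈ Icc a₁ a₂, HasDerivWithinAt (fun z => s * ((A:ℝ) + B * f' z)) (s * (B * f'' z)) (Icc a₁ a₂) z :=
    fun z hz => (hGd z hz).const_mul s
  have hK : ∀ z ∈ Icc a₁ a₂, |(B:ℝ)| / κ ≤ s * (B * f'' z) ∧ s * (B * f'' z) ≤ |(B:ℝ)| * κ := by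
    intro z hz
    rw [hsB z hz, div_eq_mul_inv]
    exact ⟨mul_le_mul_of_nonneg_left (hder2 z hz).1 hb0, mul_le_mul_of_nonneg_left (hder2 z hz).2 hb0⟩
  have hs2 : s ^ 2 = 1 := by rw [← sq_abs, hs]; norm_num
  split_ifs with hcase
  · -- one interval
    have hb : 0 < |(B:ℝ)| := by
      rcases hb0.eq_or_lt with h | h
      · rw [← h] at hcase
        have : 0 ≤ (q:ℝ) * E ^ 2 := by positivity
        linarith
      · exact h
    set b : ℝ := |(B:ℝ)| with hbdef
    set w : ℝ := Real.sqrt (c / (q * b)) with hw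
    have hwpos : 0 < w := Real.sqrt_pos.2 (by positivity)
    have hw2 : w ^ 2 = c / (q * b) := Real.sq_sqrt (by positivity)
    have hcw : c = w ^ 2 * (q * b) := by rw [hw2]; field_simp
    have hsq : Real.sqrt (c * q * b) = w * (q * b) := by
      rw [hcw, show w ^ 2 * (q * b) * q * b = (w * (q * b)) ^ 2 by ring]
      exact Real.sqrt_sq (by positivity)
    have hEw : |E| < 3 * κ * b * w := by
      apply abs_lt_of_sq_lt_sq _ (by positivity)
      have : (q:ℝ) * E ^ 2 < q * (3 * κ * b * w) ^ 2 := by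
        calc (q:ℝ) * E ^ 2 < 9 * κ ^ 2 * c * b := hcase
          _ = _ := by rw [hcw]; ring
      exact lt_of_mul_lt_mul_left this hQ.le
    have hHv : H = 3 * κ * (w * (q * b)) := by
      rw [hH, hsq]
      apply max_eq_right
      nlinarith [mul_lt_mul_of_pos_left hEw hQ]
    have hLv : 42 * κ ^ 3 * c / H = 14 * κ ^ 2 * w := by
      rw [hHv, hcw]
      field_simp
      ring
    have hδw : δ = κ * b * w ^ 2 := by
      rw [hδdef, hcw]
      field_simp
    refine ⟨x₀ - 7 * κ ^ 2 * w, x₀ + 7 * κ ^ 2 * w, by rw [hLv]; linarith, ?_⟩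
    rw [hΘ']
    rintro x ⟨hx, hFx⟩
    have ht := aux_taylor a₁ a₂ (b / κ) _ _ _ hsFd hsGd (fun z hz => (hK z hz).1) x₀ x hpq hx
    rw [← hE] at ht
    have hub : s * F x - s * F x₀ - s * E * (x - x₀) ≤ 3 * δ + |E| * |x - x₀| := by
      have e : s * F x - s * F x₀ - s * E * (x - x₀) = s * (F x - F x₀ - E * (x - x₀)) := by ring
      rw [e]
      refine (le_abs_self _).trans ?_
      rw [abs_mul, hs, one_mul]
      have h1 := abs_sub (F x - F x₀) (E * (x - x₀))
      have h2 := abs_sub (F x) (F x₀)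
      rw [abs_mul] at h1
      linarith
    have habs : |x - x₀| < 7 * κ ^ 2 * w := by
      by_contra hcon
      push Not at hcon
      rw [← sq_abs (x - x₀)] at ht
      set t := |x - x₀| with htdef
      have ht0 : 0 < t := lt_of_lt_of_le (by positivity) hcon
      have h1 : b / κ / 2 * t ^ 2 ≤ 3 * (κ * b * w ^ 2) + 3 * κ * b * w * t := by
        rw [← hδw]
        nlinarith [mul_lt_mul_of_pos_right hEw ht0]
      have h2 : t ^ 2 ≤ 6 * κ ^ 2 * w ^ 2 + 6 * κ ^ 2 * w * t := by
        have e : t ^ 2 = (2 * κ / b) * (b / κ / 2 * t ^ 2) := by field_simp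
        rw [e]
        refine (mul_le_mul_of_nonneg_left h1 (by positivity)).trans (le_of_eq ?_)
        field_simp
        ring
      have h3 : 7 * κ ^ 2 * w * t ≤ t * t := mul_le_mul_of_nonneg_right hcon ht0.le
      have h4 : κ ^ 2 * w * (7 * κ ^ 2 * w) ≤ κ ^ 2 * w * t :=
        mul_le_mul_of_nonneg_left hcon (by positivity)
      have h5 : κ ^ 2 * w ^ 2 * 1 < κ ^ 2 * w ^ 2 * κ ^ 2 := by
        exact mul_lt_mul_of_pos_left (one_lt_pow₀ hκ two_ne_zero) (by positivity)
      have h6 : 0 < κ ^ 2 * w ^ 2 := by positivity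
      have h7 : t * t = t ^ 2 := by ring
      have h8 : κ ^ 2 * w * (7 * κ ^ 2 * w) = 7 * (κ ^ 2 * w ^ 2 * κ ^ 2) := by ring
      linarith
    rw [abs_lt] at habs
    constructor <;> linarith [habs.1, habs.2]
  · -- two intervals
    push Not at hcase
    have hE0 : E ≠ 0 := by
      rintro h0
      rw [h0] at hcase
      rcases hb0.eq_or_lt with h | h
      · have hB0 : (B:ℝ) = 0 := abs_eq_zero.1 h.symm
        rw [hB0, h0] at hE
        have hA0 : (A:ℝ) = 0 := by linarith
        apply hAB
        have h1 : A = 0 := by exact_mod_cast hA0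
        have h2 : B = 0 := by exact_mod_cast hB0
        rw [h1, h2]
      · have : 0 < 9 * κ ^ 2 * c * |(B:ℝ)| := by positivity
        norm_num at hcase
        linarith
    have hEpos : 0 < |E| := abs_pos.2 hE0
    have hHv : H = q * |E| := by
      rw [hH]
      apply max_eq_left
      refine (sq_le_sq₀ (by positivity) (by positivity)).1 ?_
      rw [mul_pow, mul_pow, Real.sq_sqrt (by positivity), mul_pow, sq_abs]
      nlinarith [mul_le_mul_of_nonneg_left hcase hQ.le]
    have hLv : 42 * κ ^ 3 * c / H = 42 * κ ^ 2 * δ / |E| := by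
      rw [hHv, hδdef]
      field_simp
    have hL0 : 0 ≤ 42 * κ ^ 2 * δ / |E| := by positivity
    rw [hLv, hΘ']
    rcases hb0.eq_or_lt with h | hb
    · have hB0 : (B:ℝ) = 0 := abs_eq_zero.1 h.symm
      have hEA : E = A := by rw [hE, hB0]; ring
      obtain ⟨u, v, huv, hsub⟩ := aux_set {x ∈ Icc a₁ a₂ | |F x| < 2 * δ} (4 * δ / |E|)
        (42 * κ ^ 2 * δ / |E|) hL0 (by
          rw [← mul_div_assoc, div_le_div_iff_of_pos_right hEpos]
          nlinarith [mul_pos hδ (show (0:ℝ) < κ ^ 2 - 1 by nlinarith)]) (by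
          rintro x ⟨hx, hFx⟩ y ⟨hy, hFy⟩ hxy
          have e : F y - F x = E * (y - x) := by rw [hF, hF, hB0, hEA]; ring
          have e2 : |E| * (y - x) = |F y - F x| := by
            rw [e, abs_mul, abs_of_nonneg (sub_nonneg.2 hxy)]
          have h2 := abs_sub (F y) (F x)
          rw [lt_div_iff₀ hEpos]
          linarith)
      exact ⟨u, v, u, v, huv, huv, by rwa [union_self]⟩
    · have hset : {x ∈ Icc a₁ a₂ | |F x| < 2 * δ} = {x ∈ Icc a₁ a₂ | |s * F x| < 2 * δ} := by
        simp only [abs_mul, hs, one_mul]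
      rw [hset]
      have hsE : (s * ((A:ℝ) + B * f' x₀)) ^ 2 = E ^ 2 := by
        rw [mul_pow, hs2, one_mul, hE]
      refine aux_two a₁ a₂ (|(B:ℝ)| / κ) (|(B:ℝ)| * κ) δ (|E| / (2 * κ)) _ _ _ _ (by positivity)
        ?_ hsFd hsGd hK x₀ hpq ?_ ?_ (by positivity) ?_ ?_
      · exact (hK x₀ hpq).1.trans (hK x₀ hpq).2
      · simpa [abs_mul, hs] using hFx₀
      · rw [hsE]
        have : 9 * (|(B:ℝ)| * κ) * δ = (9 * κ ^ 2 * c * |(B:ℝ)|) / q := by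
          rw [hδdef]; ring
        rw [this, div_le_iff₀ hQ]
        linarith
      · rw [hsE, div_pow, sq_abs]
        have : 3 * (|(B:ℝ)| * κ) * (E ^ 2 / (2 * κ) ^ 2) = 3 / 4 * (|(B:ℝ)| / κ * E ^ 2) := by
          field_simp
          ring
        rw [this]
        have : 0 ≤ |(B:ℝ)| / κ * E ^ 2 := by positivity
        linarith
      · have : 8 * δ / (|E| / (2 * κ)) = 16 * κ * δ / |E| := by
          field_simp
          ring
        rw [this, div_le_div_iff_of_pos_right hEpos]
        have : κ * δ ≤ κ ^ 2 * δ := by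
          apply mul_le_mul_of_nonneg_right _ hδ.le
          nlinarith
        have : 0 < κ ^ 2 * δ := by positivity
        linarith
end
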